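/- Let Ω ⊆ ℝ^N be open, {u_k} ⊆ BV_loc(Ω) and u ∈ BV_loc(Ω) with u_k → u strongly in BV_loc(Ω), i.e. ‖u_k − u‖_{L^1(Ω')} + V(u_k − u, Ω') → 0 for every open Ω' whose closure is a compact subset of Ω. Then there exists a subsequence {u_{k_j}} such that the approximate upper limits satisfy u_{k_j}^+(x) → u^+(x) for H^{N-1}-almost every x ∈ Ω. -/

import Mathlib

open MeasureTheory Metric Filter Set
open scoped ENNReal Topology symmDiff

noncomputable section

abbrev Euc (N : ℕ) : Type := EuclideanSpace ℝ (Fin N)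

variable {N : ℕ}

/-- The divergence of a vector field `φ : ℝ^N → ℝ^N`. -/
def diverg (φ : Euc N → Euc N) (x : Euc N) : ℝ :=
  ∑ i : Fin N, fderiv ℝ φ x (EuclideanSpace.single i 1) i

/-- The admissible test vector fields for the variation in `Ω`:
`C^1`, compactly supported in `Ω`, with `‖φ‖ ≤ 1`. -/
def TestVF (Ω : Set (Euc N)) : Set (Euc N → Euc N) :=
  {φ | ContDiff ℝ 1 φ ∧ HasCompactSupport φ ∧ tsupport φ ⊆ Ω ∧ ∀ x, ‖φ x‖ ≤ 1}

/-- The total variation `V(u, Ω)`. -/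
def variation (u : Euc N → ℝ) (Ω : Set (Euc N)) : ℝ≥0∞ :=
  ⨆ φ ∈ TestVF Ω, ENNReal.ofReal (∫ x in Ω, u x * diverg φ x)

/-- The perimeter `P(A, Ω)` of `A` in `Ω`. -/
def perimeter (A Ω : Set (Euc N)) : ℝ≥0∞ :=
  ⨆ φ ∈ TestVF Ω, ENNReal.ofReal (∫ x in A, diverg φ x)

/-- `u ∈ BV(Ω)`. -/
def MemBV (u : Euc N → ℝ) (Ω : Set (Euc N)) : Prop :=
  IntegrableOn u Ω volume ∧ variation u Ω < ⊤

/-- `u ∈ BV_loc(Ω)`. -/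
def MemBVloc (u : Euc N → ℝ) (Ω : Set (Euc N)) : Prop :=
  ∀ Ω' : Set (Euc N), IsOpen Ω' → IsCompact (closure Ω') → closure Ω' ⊆ Ω → MemBV u Ω'

/-- `u ∈ GBV(Ω)`: measurable, and every truncation `(-m) ∨ u ∧ m` is in `BV_loc(Ω)`. -/
def MemGBV (u : Euc N → ℝ) (Ω : Set (Euc N)) : Prop :=
  AEMeasurable u (volume.restrict Ω) ∧
    ∀ m : ℝ, 0 < m → MemBVloc (fun x => max (-m) (min (u x) m)) Ω

/-- `A` has locally finite perimeter in `Ω`. -/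
def HasLocFinPerimeter (A Ω : Set (Euc N)) : Prop :=
  ∀ Ω' : Set (Euc N), IsOpen Ω' → IsCompact (closure Ω') → closure Ω' ⊆ Ω →
    perimeter A Ω' < ⊤

/-- `A` has density `t` at `x`. -/
def HasDensity (A : Set (Euc N)) (x : Euc N) (t : ℝ) : Prop :=
  Tendsto (fun ρ : ℝ => volume (A ∩ ball x ρ) / volume (ball x ρ)) (𝓝[>] 0)
    (𝓝 (ENNReal.ofReal t))

/-- The approximate upper limit `u⁺(x)` of `u` at `x` (relative to `Ω`), with `inf ∅ = ⊤`. -/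
def approxUpper (u : Euc N → ℝ) (Ω : Set (Euc N)) (x : Euc N) : EReal :=
  sInf {t : EReal | ∃ s : ℝ, t = (s : EReal) ∧ HasDensity {y | y ∈ Ω ∧ s < u y} x 0}

/-- The approximate lower limit `u⁻(x)` of `u` at `x` (relative to `Ω`), with `sup ∅ = ⊥`. -/
def approxLower (u : Euc N → ℝ) (Ω : Set (Euc N)) (x : Euc N) : EReal :=
  sSup {t : EReal | ∃ s : ℝ, t = (s : EReal) ∧ HasDensity {y | y ∈ Ω ∧ u y < s} x 0}

/-- The approximate limit `ũ(x)` exists (i.e. `u⁺(x) = u⁻(x)`) and is `+∞`. -/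
def HasApproxLimitTop (u : Euc N → ℝ) (Ω : Set (Euc N)) (x : Euc N) : Prop :=
  approxUpper u Ω x = ⊤ ∧ approxLower u Ω x = ⊤

/-- The approximate limit `ũ(x)` exists and `|ũ(x)| = +∞`. -/
def HasInfApproxLimit (u : Euc N → ℝ) (Ω : Set (Euc N)) (x : Euc N) : Prop :=
  (approxUpper u Ω x = ⊤ ∧ approxLower u Ω x = ⊤) ∨
    (approxUpper u Ω x = ⊥ ∧ approxLower u Ω x = ⊥)

/-- `C` is `L⁰`-polar in `Ω`. -/
def L0Polar (C Ω : Set (Euc N)) : Prop :=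
  ∃ u : Euc N → ℝ, AEMeasurable u (volume.restrict Ω) ∧
    C ⊆ {x | x ∈ Ω ∧ HasInfApproxLimit u Ω x}

/-- `C` is `BV`-polar in `Ω`. -/
def BVPolar (C Ω : Set (Euc N)) : Prop :=
  ∃ u : Euc N → ℝ, MemBV u Ω ∧ C ⊆ {x | x ∈ Ω ∧ HasInfApproxLimit u Ω x}

/-- `C` is `GBV`-polar in `Ω`. -/
def GBVPolar (C Ω : Set (Euc N)) : Prop :=
  ∃ u : Euc N → ℝ, MemGBV u Ω ∧ C ⊆ {x | x ∈ Ω ∧ HasInfApproxLimit u Ω x}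

/-- The set `A^{(1)}` of points of `Ω` where `A` has density `1`. -/
def densityOne (A Ω : Set (Euc N)) : Set (Euc N) :=
  {x | x ∈ Ω ∧ HasDensity A x 1}

/-- Real form of a variation bound. -/
def VarLe (f : Euc N → ℝ) (U : Set (Euc N)) (S : ℝ) : Prop :=
  ∀ φ ∈ TestVF U, ∫ x, f x * diverg φ x ≤ S

lemma diverg_continuous {φ : Euc N → Euc N} (h : ContDiff ℝ 1 φ) : Continuous (diverg φ) := by
  unfold diverg
  have := h.continuous_fderiv (by norm_num)
  fun_prop

lemma diverg_support {φ : Euc N → Euc N} {x : Euc N} (h : x ∉ tsupport φ) : diverg φ x = 0 := by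
  unfold diverg
  rw [fderiv_of_notMem_tsupport ℝ h]
  simp

lemma diverg_compact {φ : Euc N → Euc N} (h : HasCompactSupport φ) :
    HasCompactSupport (diverg φ) :=
  HasCompactSupport.intro h (fun _ hx => diverg_support hx)

lemma diverg_add {φ ψ : Euc N → Euc N} (h : ContDiff ℝ 1 φ) (h' : ContDiff ℝ 1 ψ) (x : Euc N) :
    diverg (fun y => φ y + ψ y) x = diverg φ x + diverg ψ x := by
  unfold diverg
  have h1 := (h.differentiable (by norm_num)).differentiableAt (x := x)
  have h2 := (h'.differentiable (by norm_num)).differentiableAt (x := x)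
  have : fderiv ℝ (fun y => φ y + ψ y) x = fderiv ℝ φ x + fderiv ℝ ψ x := fderiv_add h1 h2
  rw [this]
  simp [Finset.sum_add_distrib]

lemma diverg_sum {ι : Type*} (s : Finset ι) {φ : ι → Euc N → Euc N}
    (h : ∀ i ∈ s, ContDiff ℝ 1 (φ i)) (x : Euc N) :
    diverg (fun y => ∑ i ∈ s, φ i y) x = ∑ i ∈ s, diverg (φ i) x := by
  unfold diverg
  have : fderiv ℝ (fun y => ∑ i ∈ s, φ i y) x = ∑ i ∈ s, fderiv ℝ (φ i) x :=
    fderiv_fun_sum (fun i hi => ((h i hi).differentiable (by norm_num)).differentiableAt)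
  rw [this, Finset.sum_comm]
  simp

lemma sum_single (v : Euc N) : ∑ i : Fin N, v i • (EuclideanSpace.single i (1:ℝ)) = v := by
  ext j
  simp [Finset.sum_apply, Pi.single_apply]

lemma diverg_smul {g : Euc N → ℝ} {φ : Euc N → Euc N} (hg : ContDiff ℝ 1 g) (h : ContDiff ℝ 1 φ)
    (x : Euc N) :
    diverg (fun y => g y • φ y) x = g x * diverg φ x + fderiv ℝ g x (φ x) := by
  unfold diverg
  have h1 := (h.differentiable (by norm_num)).differentiableAt (x := x)
  have h2 := (hg.differentiable (by norm_num)).differentiableAt (x := x)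
  rw [fderiv_fun_smul h2 h1]
  conv_rhs => rw [← sum_single (φ x)]
  simp [Finset.sum_add_distrib, Finset.mul_sum, mul_comm]

lemma diverg_const_smul (c : ℝ) {φ : Euc N → Euc N} (h : ContDiff ℝ 1 φ) (x : Euc N) :
    diverg (fun y => c • φ y) x = c * diverg φ x := by
  have := diverg_smul (g := fun _ => c) contDiff_const h x
  simpa using this

lemma diverg_shift {φ : Euc N → Euc N} (y x : Euc N) :
    diverg (fun x => φ (x + y)) x = diverg φ (x + y) := by
  unfold diverg
  rw [fderiv_comp_add_right]

/-- integral of a divergence vanishes -/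
lemma integral_diverg {φ : Euc N → Euc N} (h : ContDiff ℝ 1 φ) (hc : HasCompactSupport φ) :
    ∫ x, diverg φ x = 0 := by
  unfold diverg
  have hcf := h.continuous_fderiv (by norm_num)
  have hcs : ∀ v : Euc N, ∀ i, Integrable (fun x => fderiv ℝ φ x v i) := by
    intro v i
    apply Continuous.integrable_of_hasCompactSupport (by fun_prop)
    exact HasCompactSupport.intro hc (fun x hx => by
      rw [fderiv_of_notMem_tsupport ℝ hx]; simp)
  rw [integral_finsetSum _ (fun i _ => hcs _ i)]
  apply Finset.sum_eq_zero
  intro i _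
  have key : ∀ x, fderiv ℝ φ x (EuclideanSpace.single i 1) i
      = fderiv ℝ (fun x => φ x i) x (EuclideanSpace.single i 1) := by
    intro x
    have h1 := (h.differentiable (by norm_num)).differentiableAt (x := x)
    have := ((EuclideanSpace.proj (𝕜 := ℝ) i).hasFDerivAt.comp x h1.hasFDerivAt).fderiv
    have e : ((fun v : Euc N => (EuclideanSpace.proj (𝕜 := ℝ) i : Euc N →L[ℝ] ℝ) v) ∘ φ) = fun x => φ x i := by
      ext; simp
    rw [e] at this
    rw [this]; simp
  have hcomp : ContDiff ℝ 1 (fun x => φ x i) := by fun_prop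
  have hd := hcomp.differentiable (by norm_num)
  have hsupp : HasCompactSupport (fun x => φ x i) := by
    exact HasCompactSupport.intro hc (fun x hx => by
      rw [image_eq_zero_of_notMem_tsupport hx]; simp)
  have := integral_mul_fderiv_eq_neg_fderiv_mul_of_integrable (μ := (volume : Measure (Euc N)))
    (f := fun _ => (1:ℝ)) (g := fun x => φ x i) (v := EuclideanSpace.single i 1) (by simp)
    (by simpa [key] using hcs (EuclideanSpace.single i 1) i)
    (by simpa using hcomp.continuous.integrable_of_hasCompactSupport hsupp)
    (fun _ _ => by fun_prop) (fun _ _ => hd.differentiableAt)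
  simpa [key] using this

/-- integration by parts -/
lemma ibp {g : Euc N → ℝ} {φ : Euc N → Euc N} (hg : ContDiff ℝ 1 g) (h : ContDiff ℝ 1 φ)
    (hc : HasCompactSupport φ) :
    ∫ x, g x * diverg φ x = - ∫ x, fderiv ℝ g x (φ x) := by
  have h1 := integral_diverg (φ := fun x => g x • φ x) (hg.smul h)
    (HasCompactSupport.intro hc (fun x hx => by
      rw [image_eq_zero_of_notMem_tsupport hx]; simp))
  have hcf := hg.continuous_fderiv (by norm_num)
  have hcd := diverg_continuous h
  simp_rw [diverg_smul hg h] at h1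
  rw [integral_add] at h1
  · linarith
  · apply Continuous.integrable_of_hasCompactSupport (by fun_prop)
    exact (diverg_compact hc).mul_left
  · apply Continuous.integrable_of_hasCompactSupport (hcf.clm_apply h.continuous)
    exact HasCompactSupport.intro hc (fun x hx => by
      rw [image_eq_zero_of_notMem_tsupport hx]; simp)

lemma int_mul_diverg {f : Euc N → ℝ} (hf : Integrable f) {φ : Euc N → Euc N} (h : ContDiff ℝ 1 φ)
    (hc : HasCompactSupport φ) : Integrable (fun x => f x * diverg φ x) := by
  obtain ⟨C, hC⟩ := (diverg_compact hc).exists_bound_of_continuous (diverg_continuous h)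
  exact hf.mul_bdd (diverg_continuous h).aestronglyMeasurable (Eventually.of_forall hC)

lemma testVF_mono {U U' : Set (Euc N)} (h : U ⊆ U') : TestVF U ⊆ TestVF U' :=
  fun _ hφ => ⟨hφ.1, hφ.2.1, hφ.2.2.1.trans h, hφ.2.2.2⟩

lemma zero_mem_testVF (U : Set (Euc N)) : (fun _ => 0) ∈ TestVF U := by
  refine ⟨contDiff_const, HasCompactSupport.zero, ?_, by simp⟩
  have : tsupport (fun _ : Euc N => (0 : Euc N)) = ∅ := by simp
  rw [this]; exact empty_subset _

lemma neg_mem_testVF {U : Set (Euc N)} {φ : Euc N → Euc N} (h : φ ∈ TestVF U) :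
    (fun x => - φ x) ∈ TestVF U := by
  obtain ⟨h1, h2, h3, h4⟩ := h
  have e : tsupport (fun x => - φ x) = tsupport φ := by
    simp [tsupport, Function.support]
  refine ⟨h1.neg, ?_, by rw [e]; exact h3, by simpa using h4⟩
  unfold HasCompactSupport; rw [e]; exact h2

lemma diverg_neg (φ : Euc N → Euc N) (x : Euc N) :
    diverg (fun y => - φ y) x = - diverg φ x := by
  unfold diverg
  rw [fderiv_fun_neg]; simp

lemma VarLe.nonneg {f : Euc N → ℝ} {U : Set (Euc N)} {S : ℝ} (h : VarLe f U S) : 0 ≤ S := by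
  have := h _ (zero_mem_testVF U)
  simpa [diverg] using this

lemma VarLe.abs {f : Euc N → ℝ} {U : Set (Euc N)} {S : ℝ} (h : VarLe f U S)
    {φ : Euc N → Euc N} (hφ : φ ∈ TestVF U) : |∫ x, f x * diverg φ x| ≤ S := by
  rw [abs_le']
  refine ⟨h _ hφ, ?_⟩
  have := h _ (neg_mem_testVF hφ)
  simpa [diverg_neg, integral_neg] using this

lemma VarLe.neg {f : Euc N → ℝ} {U : Set (Euc N)} {S : ℝ} (h : VarLe f U S) :
    VarLe (fun x => - f x) U S := by
  intro φ hφ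
  have := h _ (neg_mem_testVF hφ)
  simpa [diverg_neg] using this

section
open scoped ContDiff Convolution

lemma translate_L1 {f : Euc N → ℝ} (hf : Integrable f) :
    Tendsto (fun y : Euc N => ∫ x, |f (x - y) - f x|) (𝓝 0) (𝓝 0) := by
  have hL : MemLp f 1 (volume : Measure (Euc N)) := memLp_one_iff_integrable.2 hf
  have : Fact ((1:ℝ≥0∞) ≤ 1) := ⟨le_rfl⟩
  have : Fact ((1:ℝ≥0∞) ≠ ⊤) := ⟨by simp⟩
  let F := hL.toLp f
  have hc : Continuous (fun y : Euc N => DomAddAct.mk y +ᵥ F) := by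
    have h1 : Continuous (fun y : Euc N => (DomAddAct.mk y, F)) := by
      have : Continuous (DomAddAct.mk : Euc N → _) := DomAddAct.continuous_mk
      fun_prop
    exact continuous_vadd.comp h1
  have h2 : Tendsto (fun y : Euc N => dist (DomAddAct.mk (-y) +ᵥ F) F) (𝓝 0) (𝓝 0) := by
    have : Continuous (fun y : Euc N => dist (DomAddAct.mk (-y) +ᵥ F) F) := by
      have := hc.comp (continuous_neg (G := Euc N))
      exact this.dist continuous_const
    have h3 := this.tendsto 0
    have e : DomAddAct.mk (-(0:Euc N)) +ᵥ F = F := by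
      rw [neg_zero]
      have : (DomAddAct.mk (0:Euc N)) = 0 := rfl
      rw [this, zero_vadd]
    simpa [e] using h3
  refine h2.congr (fun y => ?_)
  rw [DomAddAct.mk_vadd_toLp, Lp.dist_edist, Lp.edist_toLp_toLp, eLpNorm_one_eq_lintegral_enorm,
    ← integral_norm_eq_lintegral_enorm]
  · apply integral_congr_ae
    refine Eventually.of_forall (fun x => ?_)
    simp [neg_add_eq_sub]
  · have := hL.comp_measurePreserving (measurePreserving_vadd (-y) (volume : Measure (Euc N)))
    exact this.1.sub hL.1

structure Mol (f : Euc N → ℝ) (r ε : ℝ) (η w : Euc N → ℝ) : Prop where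
  cont : Continuous η
  cpt : HasCompactSupport η
  nonneg : ∀ y, 0 ≤ η y
  int : ∫ y, η y = 1
  supp : ∀ y, r ≤ ‖y‖ → η y = 0
  eq : ∀ x, w x = ∫ y, η y * f (x - y)
  smooth : ContDiff ℝ ∞ w
  integ : Integrable w
  close : ∫ x, |w x - f x| ≤ ε

lemma mol_int {f : Euc N → ℝ} (hf : Integrable f) (hm : Measurable f) {η : Euc N → ℝ}
    (hη : Continuous η) (hηc : HasCompactSupport η) :
    Integrable (fun p : Euc N × Euc N => η p.2 * f (p.1 - p.2)) (volume.prod volume) := by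
  have h1 := hη.integrable_of_hasCompactSupport hηc (μ := volume)
  have := h1.convolution_integrand (ContinuousLinearMap.mul ℝ ℝ) hf
  simpa using this

lemma exists_mol {f : Euc N → ℝ} (hf : Integrable f) (hm : Measurable f) {r ε : ℝ}
    (hr : 0 < r) (hε : 0 < ε) : ∃ η w, Mol f r ε η w := by
  have ht := translate_L1 hf
  have := (ht.eventually (gt_mem_nhds hε))
  obtain ⟨d, hd, hd'⟩ := Metric.eventually_nhds_iff_ball.1 this
  have hp : 0 < min d r := lt_min hd hr
  let b : ContDiffBump (0 : Euc N) := ⟨min d r / 2, min d r, by positivity, by linarith⟩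
  let η := b.normed volume
  have hηc : Continuous η := b.continuous_normed
  have hηs : HasCompactSupport η := b.hasCompactSupport_normed
  have hη0 : ∀ y, 0 ≤ η y := b.nonneg_normed
  have hη1 : ∫ y, η y = 1 := b.integral_normed
  have hsup : ∀ y, min d r ≤ ‖y‖ → η y = 0 := by
    intro y hy
    by_contra hne
    have : y ∈ Function.support η := hne
    rw [b.support_normed_eq] at this
    simp only [mem_ball, dist_zero_right] at this
    change ‖y‖ < min d r at this
    linarith
  have hprod := mol_int hf hm hηc hηs
  have hηi : Integrable η := hηc.integrable_of_hasCompactSupport hηs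
  have hprod2 : Integrable (fun p : Euc N × Euc N => η p.2 * (f (p.1 - p.2) - f p.1))
      (volume.prod volume) := by
    have h2 : Integrable (fun p : Euc N × Euc N => f p.1 * η p.2) (volume.prod volume) :=
      hf.mul_prod hηi
    refine (hprod.sub h2).congr (Eventually.of_forall fun p => ?_)
    simp; ring
  refine ⟨η, fun x => ∫ y, η y * f (x - y), hηc, hηs, hη0, hη1,
    fun y hy => hsup y ((min_le_right _ _).trans hy), fun _ => rfl, ?_, ?_, ?_⟩
  · have : ContDiff ℝ ∞ (η ⋆[ContinuousLinearMap.mul ℝ ℝ, volume] f) :=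
      hηs.contDiff_convolution_left _ (b.contDiff_normed) hf.locallyIntegrable
    exact this
  · exact hprod.integral_prod_left
  · have e : ∀ᵐ x, |(∫ y, η y * f (x - y)) - f x| ≤ ∫ y, |η y * (f (x - y) - f x)| := by
      filter_upwards [hprod.prod_right_ae, hprod2.prod_right_ae] with x h1 h2
      have : (∫ y, η y * f (x - y)) - f x = ∫ y, η y * (f (x - y) - f x) := by
        simp_rw [mul_sub]
        rw [integral_sub h1 (hηi.mul_const _), integral_mul_const, hη1, one_mul]
      rw [this]
      exact abs_integral_le_integral_abs
    calc ∫ x, |(∫ y, η y * f (x - y)) - f x|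
        ≤ ∫ x, ∫ y, |η y * (f (x - y) - f x)| := by
          apply integral_mono_ae
          · exact (hprod.integral_prod_left.sub hf).abs
          · exact hprod2.abs.integral_prod_left
          · exact e
      _ = ∫ y, ∫ x, |η y * (f (x - y) - f x)| := integral_integral_swap hprod2.abs
      _ = ∫ y, η y * ∫ x, |f (x - y) - f x| := by
          congr 1; ext y
          rw [← integral_const_mul]
          simp_rw [abs_mul, abs_of_nonneg (hη0 y)]
      _ ≤ ∫ y, η y * ε := by
          apply integral_mono_of_nonneg
          · exact Eventually.of_forall fun y => mul_nonneg (hη0 y)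
              (integral_nonneg fun x => abs_nonneg _)
          · exact hηi.mul_const _
          · refine Eventually.of_forall fun y => ?_
            by_cases hy : min d r ≤ ‖y‖
            · simp [hsup y hy]
            · apply mul_le_mul_of_nonneg_left _ (hη0 y)
              apply (hd' y _).le
              rw [mem_ball, dist_zero_right]
              exact (not_le.1 hy).trans_le (min_le_left _ _)
      _ = ε := by rw [integral_mul_const, hη1, one_mul]

lemma Mol.test {f : Euc N → ℝ} (hf : Integrable f) (hm : Measurable f) {r ε : ℝ}
    {η w : Euc N → ℝ} (h : Mol f r ε η w) {G : Euc N → ℝ} (hG : Continuous G)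
    (hGc : HasCompactSupport G) {S : ℝ}
    (hS : ∀ y : Euc N, ‖y‖ < r → ∫ x, f x * G (x + y) ≤ S) : ∫ x, w x * G x ≤ S := by
  obtain ⟨C, hC⟩ := hGc.exists_bound_of_continuous hG
  have hprod := mol_int hf hm h.cont h.cpt
  have hηi : Integrable η := h.cont.integrable_of_hasCompactSupport h.cpt
  have hp2 : Integrable (fun p : Euc N × Euc N => η p.2 * f (p.1 - p.2) * G p.1)
      (volume.prod volume) :=
    hprod.mul_bdd (by fun_prop) (Eventually.of_forall fun p => hC p.1)
  calc ∫ x, w x * G x = ∫ x, ∫ y, η y * f (x - y) * G x := by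
        congr 1; ext x; rw [h.eq, integral_mul_const]
    _ = ∫ y, ∫ x, η y * f (x - y) * G x := integral_integral_swap hp2
    _ = ∫ y, η y * ∫ x, f x * G (x + y) := by
        congr 1; ext y
        rw [← integral_const_mul, ← integral_add_right_eq_self _ y]
        congr 1; ext x
        rw [add_sub_cancel_right]; ring
    _ ≤ ∫ y, η y * S := by
        apply integral_mono_ae
        · have := hp2.integral_prod_right
          refine this.congr (Eventually.of_forall fun y => ?_)
          simp only
          rw [← integral_const_mul, ← integral_add_right_eq_self _ y]
          congr 1; ext x
          rw [add_sub_cancel_right]; ring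
        · exact hηi.mul_const _
        · refine Eventually.of_forall fun y => ?_
          by_cases hy : r ≤ ‖y‖
          · simp [h.supp y hy]
          · exact mul_le_mul_of_nonneg_left (hS y (not_le.1 hy)) (h.nonneg y)
    _ = S := by rw [integral_mul_const, h.int, one_mul]

lemma Mol.bdd {f : Euc N → ℝ} {r ε : ℝ}
    {η w : Euc N → ℝ} (h : Mol f r ε η w) (hb : ∀ x, |f x| ≤ 1) (x : Euc N) : |w x| ≤ 1 := by
  have hηi : Integrable η := h.cont.integrable_of_hasCompactSupport h.cpt
  rw [h.eq]
  calc |∫ y, η y * f (x - y)| ≤ ∫ y, |η y * f (x - y)| := abs_integral_le_integral_abs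
    _ ≤ ∫ y, η y := by
      apply integral_mono_of_nonneg (Eventually.of_forall fun y => abs_nonneg _) hηi
      refine Eventually.of_forall fun y => ?_
      simp only [abs_mul, abs_of_nonneg (h.nonneg y)]
      exact mul_le_of_le_one_right (h.nonneg y) (hb _)
    _ = 1 := h.int

lemma Mol.zero {f : Euc N → ℝ} {r ε : ℝ}
    {η w : Euc N → ℝ} (h : Mol f r ε η w) {x₀ : Euc N} {ρ : ℝ}
    (hb : ∀ x, x ∉ ball x₀ ρ → f x = 0) (x : Euc N) (hx : x ∉ ball x₀ (ρ + r)) : w x = 0 := by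
  rw [h.eq]
  have : ∀ y, η y * f (x - y) = 0 := by
    intro y
    by_cases hy : r ≤ ‖y‖
    · simp [h.supp y hy]
    · rw [hb, mul_zero]
      intro hm
      apply hx
      rw [mem_ball] at hm ⊢
      calc dist x x₀ ≤ dist x (x - y) + dist (x - y) x₀ := dist_triangle _ _ _
        _ < r + ρ := by
          have : dist x (x - y) = ‖y‖ := by simp [dist_eq_norm]
          rw [this]; linarith [not_le.1 hy]
        _ = _ := by ring
  simp [this]
end

section
open scoped ContDiff

lemma lip_of_deriv {T : ℝ → ℝ} (hTd : Differentiable ℝ T) (hT1 : ∀ s, 0 ≤ deriv T s)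
    (hT2 : ∀ s, deriv T s ≤ 1) (a b : ℝ) : |T a - T b| ≤ |a - b| := by
  have := Convex.norm_image_sub_le_of_norm_deriv_le (f := T) (C := 1) (s := univ) (x := b) (y := a)
    (fun x _ => hTd x) (fun x _ => by
      rw [Real.norm_eq_abs, abs_le]; exact ⟨by linarith [hT1 x], hT2 x⟩) convex_univ
    (mem_univ _) (mem_univ _)
  simpa using this

lemma integrable_comp_T {T : ℝ → ℝ} (hTd : Differentiable ℝ T) (hT0 : T 0 = 0)
    (hT1 : ∀ s, 0 ≤ deriv T s) (hT2 : ∀ s, deriv T s ≤ 1) {g : Euc N → ℝ} (hg : Integrable g) :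
    Integrable (fun x => T (g x)) := by
  refine hg.mono (hTd.continuous.comp_aestronglyMeasurable hg.1) (Eventually.of_forall fun x => ?_)
  have := lip_of_deriv hTd hT1 hT2 (g x) 0
  simpa [hT0] using this

lemma diff_bound' {f g : Euc N → ℝ} {φ : Euc N → Euc N} {C : ℝ}
    (hC : ∀ x, ‖diverg φ x‖ ≤ C) (hf : Integrable (fun x => f x * diverg φ x))
    (hg : Integrable (fun x => g x * diverg φ x)) {k : Euc N → ℝ} (hk : Integrable k)
    (hfg : ∀ x, |f x - g x| ≤ k x) :
    |(∫ x, f x * diverg φ x) - ∫ x, g x * diverg φ x| ≤ C * ∫ x, k x := by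
  rw [← integral_sub hf hg, ← integral_const_mul]
  refine abs_integral_le_integral_abs.trans ?_
  apply integral_mono (hf.sub hg).abs (hk.const_mul C)
  intro x
  simp only [Pi.sub_apply]
  rw [← sub_mul, abs_mul, mul_comm]
  exact mul_le_mul (hC x) (hfg x) (abs_nonneg _) ((norm_nonneg _).trans (hC x))

lemma split_smooth {f : Euc N → ℝ} (hf : Integrable f) (hm : Measurable f) {U : Set (Euc N)}
    (hU : IsOpen U) {S : ℝ} (hV : VarLe f U S) {T : ℝ → ℝ} (hT : ContDiff ℝ ∞ T)
    (hT0 : T 0 = 0) (hT1 : ∀ s, 0 ≤ deriv T s) (hT2 : ∀ s, deriv T s ≤ 1)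
    {φ₁ φ₂ : Euc N → Euc N} (h1 : φ₁ ∈ TestVF U) (h2 : φ₂ ∈ TestVF U) :
    (∫ x, T (f x) * diverg φ₁ x) + ∫ x, (f x - T (f x)) * diverg φ₂ x ≤ S := by
  obtain ⟨a1, a2, a3, a4⟩ := h1
  obtain ⟨b1, b2, b3, b4⟩ := h2
  have hTd : Differentiable ℝ T := hT.differentiable (by simp)
  have hlip := lip_of_deriv hTd hT1 hT2
  have hTint : ∀ g : Euc N → ℝ, Integrable g → Integrable (fun x => T (g x)) :=
    fun g hg => integrable_comp_T hTd hT0 hT1 hT2 hg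
  obtain ⟨C1, hC1⟩ := (diverg_compact a2).exists_bound_of_continuous (diverg_continuous a1)
  obtain ⟨C2, hC2⟩ := (diverg_compact b2).exists_bound_of_continuous (diverg_continuous b1)
  have hC1' : 0 ≤ C1 := (norm_nonneg _).trans (hC1 0)
  have hC2' : 0 ≤ C2 := (norm_nonneg _).trans (hC2 0)
  obtain ⟨r, hr, hrU⟩ := (a2.union b2).exists_thickening_subset_open hU (union_subset a3 b3)
  have key : ∀ ε > 0, (∫ x, T (f x) * diverg φ₁ x) + ∫ x, (f x - T (f x)) * diverg φ₂ x
      ≤ S + (C1 + 2 * C2) * ε := by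
    intro ε hε
    obtain ⟨η, w, hw⟩ := exists_mol hf hm hr hε
    have hws : ContDiff ℝ 1 w := hw.smooth.of_le (by norm_cast)
    have hdT : ContDiff ℝ 1 (deriv T) := by
      have : ContDiff ℝ 2 T := hT.of_le (by norm_cast)
      exact ((contDiff_succ_iff_deriv (n := 1)).1 this).2.2
    let c : Euc N → ℝ := fun x => deriv T (w x)
    have hc : ContDiff ℝ 1 c := hdT.comp hws
    let ψ : Euc N → Euc N := fun x => c x • φ₁ x + (1 - c x) • φ₂ x
    have hψ : ContDiff ℝ 1 ψ := by fun_prop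
    have hz : ∀ x, x ∉ tsupport φ₁ ∪ tsupport φ₂ → ψ x = 0 := by
      intro x hx
      simp only [mem_union, not_or] at hx
      simp [ψ, image_eq_zero_of_notMem_tsupport hx.1, image_eq_zero_of_notMem_tsupport hx.2]
    have hψc : HasCompactSupport ψ := HasCompactSupport.intro (a2.union b2) hz
    have hψt : tsupport ψ ⊆ tsupport φ₁ ∪ tsupport φ₂ := by
      apply closure_minimal _ ((isClosed_tsupport _).union (isClosed_tsupport _))
      intro x hx; by_contra h; exact hx (hz x h)
    have hψn : ∀ x, ‖ψ x‖ ≤ 1 := by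
      intro x
      have h1 := hT1 (w x); have h2 := hT2 (w x)
      calc ‖ψ x‖ ≤ ‖c x • φ₁ x‖ + ‖(1 - c x) • φ₂ x‖ := norm_add_le _ _
        _ ≤ c x * 1 + (1 - c x) * 1 := by
          rw [norm_smul, norm_smul, Real.norm_eq_abs, Real.norm_eq_abs, abs_of_nonneg h1,
            abs_of_nonneg (by simp only [c]; linarith)]
          gcongr
          · exact a4 x
          · exact b4 x
        _ = 1 := by ring
    have hmain : ∫ x, w x * diverg ψ x ≤ S := by
      apply hw.test hf hm (diverg_continuous hψ) (diverg_compact hψc)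
      intro y hy
      have : (fun x => ψ (x + y)) ∈ TestVF U := by
        have ht : ∀ x, x ∉ (fun x => x + y) ⁻¹' tsupport ψ → ψ (x + y) = 0 := by
          intro x hx
          exact image_eq_zero_of_notMem_tsupport hx
        refine ⟨hψ.comp (contDiff_id.add contDiff_const),
          hψc.comp_homeomorph (Homeomorph.addRight y), ?_, fun x => hψn _⟩
        have : tsupport (fun x => ψ (x + y)) ⊆ (fun x => x + y) ⁻¹' tsupport ψ := by
          apply closure_minimal _ ((isClosed_tsupport _).preimage (by fun_prop))
          intro x hx; by_contra h; exact hx (ht x h)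
        refine this.trans ?_
        intro x hx
        apply hrU
        rw [Metric.mem_thickening_iff]
        exact ⟨x + y, hψt hx, by simpa [dist_eq_norm] using hy⟩
      have h3 := hV _ this
      simp_rw [diverg_shift] at h3
      exact h3
    have hTw : ContDiff ℝ 1 (fun x => T (w x)) := (hT.of_le (by norm_cast)).comp hws
    have hDT : ∀ x v, fderiv ℝ (fun x => T (w x)) x v = c x * fderiv ℝ w x v := by
      intro x v
      have h1 := (hws.differentiable (by norm_num)).differentiableAt (x := x)
      have := ((hTd (w x)).hasDerivAt.comp_hasFDerivAt x h1.hasFDerivAt).fderiv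
      have e : T ∘ w = fun x => T (w x) := rfl
      rw [e] at this
      rw [this]; simp [c]
    have hDw : Continuous (fderiv ℝ w) := hws.continuous_fderiv (by norm_num)
    have hi1 : Integrable (fun x => c x * fderiv ℝ w x (φ₁ x)) := by
      apply Continuous.integrable_of_hasCompactSupport
        (hc.continuous.mul (hDw.clm_apply a1.continuous))
      exact HasCompactSupport.intro a2 (fun x hx => by
        simp [image_eq_zero_of_notMem_tsupport hx])
    have hi2 : Integrable (fun x => (1 - c x) * fderiv ℝ w x (φ₂ x)) := by
      apply Continuous.integrable_of_hasCompactSupport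
        ((continuous_const.sub hc.continuous).mul (hDw.clm_apply b1.continuous))
      exact HasCompactSupport.intro b2 (fun x hx => by
        simp [image_eq_zero_of_notMem_tsupport hx])
    have hid : (∫ x, T (w x) * diverg φ₁ x) + ∫ x, (w x - T (w x)) * diverg φ₂ x
        = ∫ x, w x * diverg ψ x := by
      rw [ibp hTw a1 a2, ibp (hws.sub hTw) b1 b2, ibp hws hψ hψc]
      have e2 : ∀ x, fderiv ℝ (fun x => w x - T (w x)) x (φ₂ x)
          = (1 - c x) * fderiv ℝ w x (φ₂ x) := by
        intro x
        have h1 := (hws.differentiable (by norm_num)).differentiableAt (x := x)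
        have h2 := (hTw.differentiable (by norm_num)).differentiableAt (x := x)
        rw [fderiv_fun_sub h1 h2]
        simp only [sub_apply, hDT]; ring
      simp_rw [hDT, e2]
      rw [← neg_add, ← integral_add hi1 hi2]
      congr 2; ext x
      simp [ψ]
    have hk : Integrable (fun x => |w x - f x|) := (hw.integ.sub hf).abs
    have d1 := diff_bound' hC1 (int_mul_diverg (hTint f hf) a1 a2)
      (int_mul_diverg (hTint w hw.integ) a1 a2) hk
      (fun x => by rw [abs_sub_comm (w x)]; exact hlip _ _)
    have d2 := diff_bound' hC2 (int_mul_diverg (hf.sub (hTint f hf)) b1 b2)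
      (int_mul_diverg (hw.integ.sub (hTint w hw.integ)) b1 b2) (hk.const_mul 2)
      (fun x => by
        simp only [Pi.sub_apply]
        have := hlip (f x) (w x)
        rw [abs_sub_comm (w x)]
        calc |f x - T (f x) - (w x - T (w x))| = |(f x - w x) - (T (f x) - T (w x))| := by ring_nf
          _ ≤ |f x - w x| + |T (f x) - T (w x)| := abs_sub _ _
          _ ≤ _ := by linarith)
    rw [integral_const_mul] at d2
    simp only [Pi.sub_apply] at d2
    have m1 : C1 * ∫ x, |w x - f x| ≤ C1 * ε := mul_le_mul_of_nonneg_left hw.close hC1'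
    have m2 : C2 * (2 * ∫ x, |w x - f x|) ≤ C2 * (2 * ε) := by
      have := hw.close
      gcongr
    have := (abs_le.1 d1).2; have := (abs_le.1 d2).2
    nlinarith
  apply le_of_forall_pos_le_add
  intro ε hε
  have hpos : 0 < C1 + 2 * C2 + 1 := by linarith
  have := key (ε / (C1 + 2 * C2 + 1)) (by positivity)
  refine this.trans ?_
  have : (C1 + 2 * C2) * (ε / (C1 + 2 * C2 + 1)) ≤ ε := by
    rw [mul_div_assoc', div_le_iff₀ hpos]; nlinarith
  linarith

/-- Sharp splitting along a positive part. -/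
lemma split_pos {f : Euc N → ℝ} (hf : Integrable f) (hm : Measurable f) {U : Set (Euc N)}
    (hU : IsOpen U) {S : ℝ} (hV : VarLe f U S) {t : ℝ} (ht : 0 ≤ t)
    {φ₁ φ₂ : Euc N → Euc N} (h1 : φ₁ ∈ TestVF U) (h2 : φ₂ ∈ TestVF U) :
    (∫ x, max (f x - t) 0 * diverg φ₁ x) + ∫ x, (f x - max (f x - t) 0) * diverg φ₂ x ≤ S := by
  have hi : Integrable (fun x => max (f x - t) 0) := by
    refine hf.mono (by fun_prop) (Eventually.of_forall fun x => ?_)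
    rw [Real.norm_eq_abs, Real.norm_eq_abs, abs_of_nonneg (le_max_right _ _)]
    exact max_le (by linarith [le_abs_self (f x)]) (abs_nonneg _)
  have I1 : Integrable (fun x => |diverg φ₁ x|) :=
    ((diverg_continuous h1.1).integrable_of_hasCompactSupport (diverg_compact h1.2.1)).abs
  have I2 : Integrable (fun x => |diverg φ₂ x|) :=
    ((diverg_continuous h2.1).integrable_of_hasCompactSupport (diverg_compact h2.2.1)).abs
  have key : ∀ ε > 0, (∫ x, max (f x - t) 0 * diverg φ₁ x)
      + ∫ x, (f x - max (f x - t) 0) * diverg φ₂ x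
      ≤ S + ε * ((∫ x, |diverg φ₁ x|) + ∫ x, |diverg φ₂ x|) := by
    intro ε hε
    have hsq : ∀ s : ℝ, 0 < (s - t) ^ 2 + ε ^ 2 := fun s => by positivity
    let P : ℝ → ℝ := fun s => ((s - t) + √((s - t) ^ 2 + ε ^ 2)) / 2
    let T : ℝ → ℝ := fun s => P s - P 0
    have hPs : ContDiff ℝ ∞ P := by
      have : ContDiff ℝ ∞ (fun s : ℝ => √((s - t) ^ 2 + ε ^ 2)) :=
        ContDiff.sqrt (by fun_prop) (fun s => (hsq s).ne')
      fun_prop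
    have hTs : ContDiff ℝ ∞ T := by fun_prop
    have hder : ∀ s, deriv T s = (1 + (s - t) / √((s - t) ^ 2 + ε ^ 2)) / 2 := by
      intro s
      have e1 : HasDerivAt (fun s : ℝ => (s - t) ^ 2 + ε ^ 2) (2 * (s - t)) s := by
        have := (((hasDerivAt_id s).sub_const t).pow 2).add_const (ε ^ 2)
        simpa using this
      have e2 := e1.sqrt (hsq s).ne'
      have e3 : HasDerivAt T ((1 + 2 * (s - t) / (2 * √((s - t) ^ 2 + ε ^ 2))) / 2) s :=
        ((((hasDerivAt_id s).sub_const t).add e2).div_const 2).sub_const (P 0)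
      rw [e3.deriv]
      have := Real.sqrt_pos.2 (hsq s)
      field_simp
    have habs : ∀ s, |(s - t) / √((s - t) ^ 2 + ε ^ 2)| ≤ 1 := by
      intro s
      have hp := Real.sqrt_pos.2 (hsq s)
      rw [abs_div, abs_of_pos hp, div_le_one hp]
      apply Real.le_sqrt_of_sq_le
      rw [sq_abs]; nlinarith [sq_nonneg ε]
    have hPb : ∀ s, |P s - max (s - t) 0| ≤ ε / 2 := by
      intro s
      have l1 : |s - t| ≤ √((s - t) ^ 2 + ε ^ 2) := by
        apply Real.le_sqrt_of_sq_le
        rw [sq_abs]; nlinarith [sq_nonneg ε]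
      have l2 : √((s - t) ^ 2 + ε ^ 2) ≤ |s - t| + ε := by
        apply Real.sqrt_le_iff.2
        refine ⟨by positivity, ?_⟩
        nlinarith [sq_abs (s - t), abs_nonneg (s - t)]
      have : max (s - t) 0 = ((s - t) + |s - t|) / 2 := by
        rcases le_total 0 (s - t) with h | h
        · rw [max_eq_left h, abs_of_nonneg h]; ring
        · rw [max_eq_right h, abs_of_nonpos h]; ring
      rw [this, abs_le]
      constructor <;> simp only [P] <;> linarith
    have hTb : ∀ s, |T s - max (s - t) 0| ≤ ε := by
      intro s
      have q1 := abs_le.1 (hPb s)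
      have q2 := abs_le.1 (hPb 0)
      have : max (0 - t) 0 = 0 := max_eq_right (by linarith)
      rw [this] at q2
      rw [abs_le]
      constructor <;> simp only [T] <;> linarith [q1.1, q1.2, q2.1, q2.2]
    have q1 : ∀ s, 0 ≤ deriv T s := fun s => by rw [hder]; linarith [(abs_le.1 (habs s)).1]
    have q2 : ∀ s, deriv T s ≤ 1 := fun s => by rw [hder]; linarith [(abs_le.1 (habs s)).2]
    have hmain := split_smooth hf hm hU hV hTs (by simp [T]) q1 q2 h1 h2
    have hTi : Integrable (fun x => T (f x)) :=
      integrable_comp_T (hTs.differentiable (by simp)) (by simp [T]) q1 q2 hf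
    have g1 : (∫ x, max (f x - t) 0 * diverg φ₁ x) - ∫ x, T (f x) * diverg φ₁ x
        ≤ ε * ∫ x, |diverg φ₁ x| := by
      rw [← integral_sub (int_mul_diverg hi h1.1 h1.2.1) (int_mul_diverg hTi h1.1 h1.2.1),
        ← integral_const_mul]
      apply integral_mono ((int_mul_diverg hi h1.1 h1.2.1).sub (int_mul_diverg hTi h1.1 h1.2.1))
        (I1.const_mul _)
      intro x
      simp only [Pi.sub_apply]
      rw [← sub_mul]
      refine (le_abs_self _).trans ?_
      rw [abs_mul, abs_sub_comm]
      exact mul_le_mul_of_nonneg_right (hTb _) (abs_nonneg _)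
    have g2 : (∫ x, (f x - max (f x - t) 0) * diverg φ₂ x)
        - ∫ x, (f x - T (f x)) * diverg φ₂ x ≤ ε * ∫ x, |diverg φ₂ x| := by
      have j1 := int_mul_diverg (hf.sub hi) h2.1 h2.2.1
      have j2 := int_mul_diverg (hf.sub hTi) h2.1 h2.2.1
      simp only [Pi.sub_apply] at j1 j2
      rw [← integral_sub j1 j2, ← integral_const_mul]
      apply integral_mono (j1.sub j2) (I2.const_mul _)
      intro x
      simp only [Pi.sub_apply]
      rw [← sub_mul]
      refine (le_abs_self _).trans ?_
      rw [abs_mul]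
      refine mul_le_mul_of_nonneg_right ?_ (abs_nonneg _)
      have := hTb (f x)
      rwa [sub_sub_sub_cancel_left]
    linarith
  have hA : 0 ≤ (∫ x, |diverg φ₁ x|) + ∫ x, |diverg φ₂ x| :=
    add_nonneg (integral_nonneg fun _ => abs_nonneg _) (integral_nonneg fun _ => abs_nonneg _)
  set A := (∫ x, |diverg φ₁ x|) + ∫ x, |diverg φ₂ x| with hAdef
  apply le_of_forall_pos_le_add
  intro ε hε
  have hpos : 0 < A + 1 := by linarith
  refine (key (ε / (A + 1)) (by positivity)).trans ?_
  have : ε / (A + 1) * A ≤ ε := by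
    rw [div_mul_eq_mul_div, div_le_iff₀ hpos]; nlinarith
  linarith
end

lemma VarLe.const_mul {f : Euc N → ℝ} {U : Set (Euc N)} {S : ℝ} (h : VarLe f U S) {c : ℝ}
    (hc : 0 ≤ c) : VarLe (fun x => c * f x) U (c * S) := by
  intro φ hφ
  simp_rw [mul_assoc]
  rw [integral_const_mul]
  exact mul_le_mul_of_nonneg_left (h φ hφ) hc

lemma int_pos {f : Euc N → ℝ} (hf : Integrable f) {t : ℝ} (ht : 0 ≤ t) :
    Integrable (fun x => max (f x - t) 0) := by
  have h1 := hf.1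
  refine hf.mono (by fun_prop) (Eventually.of_forall fun x => ?_)
  rw [Real.norm_eq_abs, Real.norm_eq_abs, abs_of_nonneg (le_max_right _ _)]
  exact max_le (by linarith [le_abs_self (f x)]) (abs_nonneg _)

lemma VarLe.pos {f : Euc N → ℝ} (hf : Integrable f) (hm : Measurable f) {U : Set (Euc N)}
    (hU : IsOpen U) {S : ℝ} (hV : VarLe f U S) {t : ℝ} (ht : 0 ≤ t) :
    VarLe (fun x => max (f x - t) 0) U S := by
  intro φ hφ
  have := split_pos hf hm hU hV ht hφ (zero_mem_testVF U)
  simpa [diverg] using this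

lemma sub_pos_eq_min (s t : ℝ) : s - max (s - t) 0 = min s t := by
  rcases le_total s t with h | h
  · rw [max_eq_right (by linarith), min_eq_left h, sub_zero]
  · rw [max_eq_left (by linarith), min_eq_right h]; ring

lemma int_min {f : Euc N → ℝ} (hf : Integrable f) {t : ℝ} (ht : 0 ≤ t) :
    Integrable (fun x => min (f x) t) := by
  refine (hf.sub (int_pos hf ht)).congr (Eventually.of_forall fun x => ?_)
  simp [sub_pos_eq_min]

lemma VarLe.min {f : Euc N → ℝ} (hf : Integrable f) (hm : Measurable f) {U : Set (Euc N)}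
    (hU : IsOpen U) {S : ℝ} (hV : VarLe f U S) {t : ℝ} (ht : 0 ≤ t) :
    VarLe (fun x => min (f x) t) U S := by
  intro φ hφ
  have := split_pos hf hm hU hV ht (zero_mem_testVF U) hφ
  simp_rw [sub_pos_eq_min] at this
  simpa [diverg] using this

lemma VarLe.half {f : Euc N → ℝ} (hf : Integrable f) (hm : Measurable f) {U : Set (Euc N)}
    (hU : IsOpen U) {S : ℝ} (hV : VarLe f U S) :
    VarLe (fun x => 2 * Min.min (f x) (1/2)) U S ∨ VarLe (fun x => 2 * max (f x - 1/2) 0) U S := by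
  by_cases h : VarLe (fun x => Min.min (f x) (1/2)) U (S / 2)
  · left
    have := h.const_mul (c := 2) (by norm_num)
    rwa [mul_div_cancel₀ _ (by norm_num)] at this
  · right
    simp only [VarLe, not_forall, not_le] at h
    obtain ⟨φ, hφ, hlt⟩ := h
    have : VarLe (fun x => max (f x - 1/2) 0) U (S / 2) := by
      intro ψ hψ
      have := split_pos hf hm hU hV (t := 1/2) (by norm_num) hψ hφ
      simp_rw [sub_pos_eq_min] at this
      linarith
    have := this.const_mul (c := 2) (by norm_num)
    rwa [mul_div_cancel₀ _ (by norm_num)] at this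

lemma varLe_of_tendsto {g : ℕ → Euc N → ℝ} {G : Euc N → ℝ} {U : Set (Euc N)} {S : ℝ}
    (hm : ∀ n, Measurable (g n)) (hb : ∀ n x, |g n x| ≤ 1)
    (ht : ∀ x, Tendsto (fun n => g n x) atTop (𝓝 (G x))) (hV : ∀ n, VarLe (g n) U S) :
    VarLe G U S := by
  intro φ hφ
  have hI : Integrable (fun x => |diverg φ x|) :=
    ((diverg_continuous hφ.1).integrable_of_hasCompactSupport (diverg_compact hφ.2.1)).abs
  have : Tendsto (fun n => ∫ x, g n x * diverg φ x) atTop (𝓝 (∫ x, G x * diverg φ x)) := by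
    apply tendsto_integral_of_dominated_convergence _ _ hI
    · intro n
      refine Eventually.of_forall fun x => ?_
      rw [Real.norm_eq_abs, abs_mul]
      exact mul_le_of_le_one_left (abs_nonneg _) (hb n x)
    · exact Eventually.of_forall fun x => (ht x).mul_const _
    · intro n
      exact (hm n).aestronglyMeasurable.mul (diverg_continuous hφ.1).aestronglyMeasurable
  exact le_of_tendsto' this fun n => hV n φ hφ

lemma exists_levels {f : Euc N → ℝ} (hf : Integrable f) (hm : Measurable f) {U : Set (Euc N)}
    (hU : IsOpen U) {S : ℝ} (hV : VarLe f U S) :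
    ∃ D : ℕ → ℝ → ℝ, D 0 = id ∧ (∀ n, D (n+1) = (fun s => 2 * min (D n s) (1/2)) ∨
      D (n+1) = (fun s => 2 * max (D n s - 1/2) 0)) ∧ ∀ n, Continuous (D n) ∧
      Integrable (fun x => D n (f x)) ∧ VarLe (fun x => D n (f x)) U S := by
  let P : (ℝ → ℝ) → Prop := fun D => Continuous D ∧
      Integrable (fun x => D (f x)) ∧ VarLe (fun x => D (f x)) U S
  have step : ∀ D, P D → ∃ D', P D' ∧ (D' = (fun s => 2 * min (D s) (1/2)) ∨
      D' = (fun s => 2 * max (D s - 1/2) 0)) := by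
    rintro D ⟨h1, h2, h3⟩
    rcases h3.half h2 (h1.measurable.comp hm) hU with h | h
    · exact ⟨_, ⟨by fun_prop, (int_min h2 (by norm_num)).const_mul 2, h⟩, Or.inl rfl⟩
    · exact ⟨_, ⟨by fun_prop, (int_pos h2 (by norm_num)).const_mul 2, h⟩, Or.inr rfl⟩
  choose F hF1 hF2 using step
  let G : ℕ → {D : ℝ → ℝ // P D} := fun n => Nat.rec
    ⟨id, continuous_id, hf, hV⟩ (fun _ D => ⟨F D.1 D.2, hF1 D.1 D.2⟩) n
  exact ⟨fun n => (G n).1, rfl, fun n => hF2 (G n).1 (G n).2, fun n => (G n).2⟩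

/-- A good level set. -/
lemma coarea {f : Euc N → ℝ} (hf : Integrable f) (hm : Measurable f) {U : Set (Euc N)}
    (hU : IsOpen U) {S : ℝ} (hV : VarLe f U S) (h0 : ∀ x, 0 ≤ f x) (h1 : ∀ x, f x ≤ 1) :
    ∃ E : Set (Euc N), MeasurableSet E ∧ (∀ x, f x = 1 → x ∈ E) ∧ (∀ x ∈ E, 0 < f x) ∧
      VarLe (E.indicator 1) U (2 * S) := by
  obtain ⟨D, hD0, hDs, hD⟩ := exists_levels hf hm hU hV
  have r01 : ∀ n s, 0 ≤ s → s ≤ 1 → 0 ≤ D n s ∧ D n s ≤ 1 := by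
    intro n
    induction n with
    | zero => intro s a b; simp [hD0, a, b]
    | succ n ih =>
      intro s a b
      obtain ⟨c, d⟩ := ih s a b
      rcases hDs n with h | h <;> rw [h] <;> simp only <;> constructor
      · have : 0 ≤ min (D n s) (1/2) := le_min c (by norm_num)
        linarith
      · have := min_le_right (D n s) (1/2)
        linarith
      · have := le_max_right (D n s - 1/2) 0
        linarith
      · have : max (D n s - 1/2) 0 ≤ 1/2 := max_le (by linarith) (by norm_num)
        linarith
  have z0 : ∀ n s, D n s = 0 → ∀ k, D (n + k) s = 0 := by
    intro n s h k
    induction k with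
    | zero => exact h
    | succ k ih =>
      rcases hDs (n + k) with h | h <;> rw [← add_assoc, h] <;> simp only [ih] <;> norm_num
  have z1 : ∀ n s, D n s = 1 → ∀ k, D (n + k) s = 1 := by
    intro n s h k
    induction k with
    | zero => exact h
    | succ k ih =>
      rcases hDs (n + k) with h | h <;> rw [← add_assoc, h] <;> simp only [ih] <;> norm_num
  have step : ∀ n s, 0 < D (n+1) s → D (n+1) s < 1 →
      (D (n+1) = (fun s => 2 * min (D n s) (1/2)) → D (n+1) s = 2 * D n s) ∧
      (D (n+1) = (fun s => 2 * max (D n s - 1/2) 0) → D (n+1) s = 2 * D n s - 1) := by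
    intro n s a b
    constructor
    · intro h; rw [h] at a b ⊢; simp only at a b ⊢
      rcases le_total (D n s) (1/2) with c | c
      · rw [min_eq_left c]
      · rw [min_eq_right c] at b; norm_num at b
    · intro h; rw [h] at a b ⊢; simp only at a b ⊢
      rcases le_total (D n s - 1/2) 0 with c | c
      · rw [max_eq_right c] at a; norm_num at a
      · rw [max_eq_left c]; ring
  have uniq : ∀ s s', (∀ n, 0 < D n s ∧ D n s < 1) → (∀ n, 0 < D n s' ∧ D n s' < 1) → s = s' := by
    intro s s' hs hs'
    have hdiff : ∀ n, D n s - D n s' = 2 ^ n * (s - s') := by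
      intro n
      induction n with
      | zero => simp [hD0]
      | succ n ih =>
        have a := step n s (hs _).1 (hs _).2
        have b := step n s' (hs' _).1 (hs' _).2
        rcases hDs n with h | h
        · rw [a.1 h, b.1 h, pow_succ]; linarith
        · rw [a.2 h, b.2 h, pow_succ]; linarith
    by_contra hne
    have hp : 0 < |s - s'| := abs_pos.2 (sub_ne_zero.2 hne)
    obtain ⟨n, hn⟩ := pow_unbounded_of_one_lt (1 / |s - s'|) (by norm_num : (1:ℝ) < 2)
    have h2 : |D n s - D n s'| < 1 := by
      rw [abs_lt]; constructor <;> linarith [(hs n).1, (hs n).2, (hs' n).1, (hs' n).2]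
    rw [hdiff, abs_mul, abs_of_pos (by positivity : (0:ℝ) < 2 ^ n)] at h2
    rw [div_lt_iff₀ hp] at hn
    linarith
  have tri : ∀ s, 0 ≤ s → s ≤ 1 → (∃ n, D n s = 0) ∨ (∃ n, D n s = 1) ∨
      (∀ n, 0 < D n s ∧ D n s < 1) := by
    intro s a b
    by_cases h : ∃ n, D n s = 0
    · exact Or.inl h
    by_cases h' : ∃ n, D n s = 1
    · exact Or.inr (Or.inl h')
    push Not at h h'
    exact Or.inr (Or.inr fun n => ⟨lt_of_le_of_ne (r01 n s a b).1 (h n).symm,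
      lt_of_le_of_ne (r01 n s a b).2 (h' n)⟩)
  have hDm : ∀ n, Measurable (fun x => D n (f x)) := fun n => (hD n).1.measurable.comp hm
  have excl : ∀ s, (∃ n, D n s = 0) → (∃ n, D n s = 1) → False := by
    rintro s ⟨n, hn⟩ ⟨m, hm⟩
    have a := z0 n s hn m
    have b := z1 m s hm n
    rw [add_comm] at b; rw [a] at b; norm_num at b
  have ev0 : ∀ s, (∃ n, D n s = 0) → ∀ᶠ n in atTop, D n s = 0 := by
    rintro s ⟨n, hn⟩
    filter_upwards [eventually_ge_atTop n] with m hm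
    obtain ⟨k, rfl⟩ := Nat.exists_eq_add_of_le hm
    exact z0 n s hn k
  have ev1 : ∀ s, (∃ n, D n s = 1) → ∀ᶠ n in atTop, D n s = 1 := by
    rintro s ⟨n, hn⟩
    filter_upwards [eventually_ge_atTop n] with m hm
    obtain ⟨k, rfl⟩ := Nat.exists_eq_add_of_le hm
    exact z1 n s hn k
  by_cases hcase : ∃ᶠ n in atTop, ∀ s, (∀ n, 0 < D n s ∧ D n s < 1) → D n s ≤ 1/2
  · obtain ⟨ν, hν, hν'⟩ := extraction_of_frequently_atTop hcase
    refine ⟨{x | ∃ n, D n (f x) = 1}, ?_, fun x hx => ⟨0, by simp [hD0, hx]⟩, ?_, ?_⟩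
    · rw [ofPred_exists]
      exact MeasurableSet.iUnion fun n => hDm n (measurableSet_singleton 1)
    · intro x hx
      refine lt_of_le_of_ne (h0 x) fun h => ?_
      exact excl (f x) ⟨0, by simp [hD0, ← h]⟩ hx
    · apply varLe_of_tendsto (g := fun n x => 2 * max (D (ν n) (f x) - 1/2) 0)
      · intro n
        exact (((hDm (ν n)).sub_const _).max measurable_const).const_mul 2
      · intro n x
        have := r01 (ν n) (f x) (h0 x) (h1 x)
        rw [abs_of_nonneg (by positivity)]
        have : max (D (ν n) (f x) - 1/2) 0 ≤ 1/2 := max_le (by linarith) (by norm_num)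
        linarith
      · intro x
        rcases tri (f x) (h0 x) (h1 x) with h | h | h
        · have hx : x ∉ {x | ∃ n, D n (f x) = 1} := fun h' => excl _ h h'
          rw [indicator_of_notMem hx]
          apply tendsto_const_nhds.congr'
          filter_upwards [hν.tendsto_atTop.eventually (ev0 _ h)] with n hn
          rw [hn]; norm_num
        · have hx : x ∈ {x | ∃ n, D n (f x) = 1} := h
          rw [indicator_of_mem hx]
          apply tendsto_const_nhds.congr'
          filter_upwards [hν.tendsto_atTop.eventually (ev1 _ h)] with n hn
          rw [hn]; norm_num
        · have hx : x ∉ {x | ∃ n, D n (f x) = 1} := by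
            rintro ⟨n, hn⟩; exact (h n).2.ne hn
          rw [indicator_of_notMem hx]
          apply tendsto_const_nhds.congr
          intro n
          have := hν' n (f x) h
          rw [max_eq_right (by linarith), mul_zero]
      · intro n
        exact ((hD (ν n)).2.2.pos (hD (ν n)).2.1 (hDm _) hU (by norm_num)).const_mul (by norm_num)
  · rw [not_frequently] at hcase
    refine ⟨{x | ∀ n, D n (f x) ≠ 0}, ?_, ?_, ?_, ?_⟩
    · rw [ofPred_forall]
      exact MeasurableSet.iInter fun n => (hDm n (measurableSet_singleton 0)).compl
    · intro x hx n hn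
      exact excl (f x) ⟨n, hn⟩ ⟨0, by simp [hD0, hx]⟩
    · intro x hx
      refine lt_of_le_of_ne (h0 x) fun h => hx 0 (by simp [hD0, ← h])
    · apply varLe_of_tendsto (g := fun n x => 2 * Min.min (D n (f x)) (1/2))
      · intro n
        exact ((hDm n).min measurable_const).const_mul 2
      · intro n x
        have := r01 n (f x) (h0 x) (h1 x)
        have h2 : 0 ≤ Min.min (D n (f x)) (1/2) := le_min this.1 (by norm_num)
        rw [abs_of_nonneg (by positivity)]
        have := min_le_right (D n (f x)) (1/2)
        linarith
      · intro x
        rcases tri (f x) (h0 x) (h1 x) with h | h | h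
        · have hx : x ∉ {x | ∀ n, D n (f x) ≠ 0} := fun h' => by
            obtain ⟨n, hn⟩ := h; exact h' n hn
          rw [indicator_of_notMem hx]
          apply tendsto_const_nhds.congr'
          filter_upwards [ev0 _ h] with n hn
          rw [hn]; norm_num
        · have hx : x ∈ {x | ∀ n, D n (f x) ≠ 0} := fun n hn => excl _ ⟨n, hn⟩ h
          rw [indicator_of_mem hx]
          apply tendsto_const_nhds.congr'
          filter_upwards [ev1 _ h] with n hn
          rw [hn]; norm_num
        · have hx : x ∈ {x | ∀ n, D n (f x) ≠ 0} := fun n => (h n).1.ne'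
          rw [indicator_of_mem hx]
          apply tendsto_const_nhds.congr'
          filter_upwards [hcase] with n hn
          push Not at hn
          obtain ⟨s, hs, hs'⟩ := hn
          rw [uniq (f x) s h hs, min_eq_right hs'.le]; norm_num
      · intro n
        exact ((hD n).2.2.min (hD n).2.1 (hDm _) hU (by norm_num)).const_mul (by norm_num)

lemma dir_le {h : Euc N → ℝ} {U : Set (Euc N)} {S : ℝ} (hV : VarLe h U S) {k : Euc N → ℝ}
    (hk : ContDiff ℝ 1 k) (hkb : ∀ x, |k x| ≤ 1) {K : Set (Euc N)} (hK : IsCompact K) (hKU : K ⊆ U)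
    (hk0 : ∀ x, x ∉ K → k x = 0) {e : Euc N} (he : ‖e‖ ≤ 1) : ∫ x, h x * fderiv ℝ k x e ≤ S := by
  have hsup : tsupport (fun x => k x • e) ⊆ K := by
    apply closure_minimal _ hK.isClosed
    intro x hx
    by_contra hxK
    exact hx (by simp [hk0 x hxK])
  have hc : ContDiff ℝ 1 (fun x => k x • e) := hk.smul contDiff_const
  have := hV (fun x => k x • e) ⟨hc, ?_, hsup.trans hKU, ?_⟩
  · convert this using 3 with x
    rw [diverg_smul hk contDiff_const]
    simp [diverg]
  · exact hK.of_isClosed_subset (isClosed_tsupport _) hsup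
  · intro x
    rw [norm_smul, Real.norm_eq_abs]
    exact mul_le_one₀ (hkb x) (norm_nonneg _) he

lemma trans_smooth {h : Euc N → ℝ} (hf : Integrable h) {x₀ : Euc N} {r ρ : ℝ} {S : ℝ}
    (hV : VarLe h (ball x₀ r) S) {z : Euc N} (hr : ρ + ‖z‖ < r) {g : Euc N → ℝ}
    (hg : ContDiff ℝ 1 g) (hgb : ∀ x, |g x| ≤ 1) (hg0 : ∀ x, x ∉ ball x₀ ρ → g x = 0) :
    ∫ x, h x * (g (x - z) - g x) ≤ ‖z‖ * S := by
  have hcg : HasCompactSupport g := HasCompactSupport.intro (isCompact_closedBall x₀ ρ)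
    (fun x hx => hg0 x (fun h => hx (ball_subset_closedBall h)))
  have hgc := hg.continuous
  have hgd := hg.continuous_fderiv (by norm_num)
  obtain ⟨C, hC⟩ := (hcg.fderiv (𝕜 := ℝ)).exists_bound_of_continuous hgd
  have hintb : ∀ k : Euc N → ℝ, Continuous k → (∃ B, ∀ x, ‖k x‖ ≤ B) → Integrable (fun x => h x * k x) := by
    rintro k hk ⟨B, hB⟩
    exact hf.mul_bdd hk.aestronglyMeasurable (Eventually.of_forall hB)
  have hF1 : ∀ t : ℝ, Integrable (fun x => h x * g (x - t • z)) := fun t =>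
    hintb (fun x => g (x - t • z)) (by fun_prop) ⟨1, fun x => hgb _⟩
  have hder : ∀ t : ℝ, HasDerivAt (fun t => ∫ x, h x * g (x - t • z))
      (∫ x, h x * - fderiv ℝ g (x - t • z) z) t := by
    intro t
    refine (hasDerivAt_integral_of_dominated_loc_of_deriv_le (bound := fun x => ‖h x‖ * (C * ‖z‖))
      (F := fun t x => h x * g (x - t • z)) (F' := fun t x => h x * - fderiv ℝ g (x - t • z) z)
      (s := univ) univ_mem (Eventually.of_forall fun t => (hF1 t).1) (hF1 t)
      ?_ ?_ (hf.norm.mul_const _) ?_).2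
    · have : Continuous fun x => - fderiv ℝ g (x - t • z) z := by fun_prop
      exact hf.1.mul this.aestronglyMeasurable
    · refine Eventually.of_forall fun x s _ => ?_
      rw [norm_mul, norm_neg]
      gcongr
      exact ((fderiv ℝ g (x - s • z)).le_opNorm z).trans (by gcongr; exact hC _)
    · refine Eventually.of_forall fun x s _ => ?_
      apply HasDerivAt.const_mul
      have h1 : HasDerivAt (fun s : ℝ => x - s • z) (-z) s := by
        simpa using ((hasDerivAt_id s).smul_const z).const_sub x
      have h2 := ((hg.differentiable (by norm_num)) (x - s • z)).hasFDerivAt.comp_hasDerivAt s h1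
      rw [map_neg] at h2
      exact h2
  have hbound : ∀ t ∈ Icc (0:ℝ) 1, ∫ x, h x * - fderiv ℝ g (x - t • z) z ≤ ‖z‖ * S := by
    intro t ht
    by_cases hz : z = 0
    · subst hz; simp
    have hz' : 0 < ‖z‖ := norm_pos_iff.2 hz
    have := dir_le hV (k := fun x => - g (x - t • z)) (K := closedBall x₀ (ρ + ‖z‖))
      (e := ‖z‖⁻¹ • z) (by fun_prop) (by simpa using fun x => hgb _) (isCompact_closedBall _ _)
      (closedBall_subset_ball hr) ?_ ?_
    · have h2 : ∀ x, h x * - fderiv ℝ g (x - t • z) z =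
          ‖z‖ * (h x * fderiv ℝ (fun x => - g (x - t • z)) x (‖z‖⁻¹ • z)) := by
        intro x
        rw [fderiv_fun_neg, fderiv_comp_sub]
        simp only [map_smul, _root_.neg_apply, smul_eq_mul]
        field_simp
      simp_rw [h2]
      rw [integral_const_mul]
      exact mul_le_mul_of_nonneg_left this hz'.le
    · intro x hx
      rw [hg0, neg_zero]
      intro hx'
      apply hx
      rw [mem_closedBall]
      rw [mem_ball] at hx'
      have e1 : dist x (x - t • z) = t * ‖z‖ := by
        rw [dist_eq_norm, sub_sub_cancel, norm_smul, Real.norm_eq_abs, abs_of_nonneg ht.1]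
      have e2 : t * ‖z‖ ≤ ‖z‖ := mul_le_of_le_one_left (norm_nonneg _) ht.2
      linarith [dist_triangle x (x - t • z) x₀]
    · rw [norm_smul, norm_inv, norm_norm, inv_mul_cancel₀ hz'.ne']
  have hmv := Convex.image_sub_le_mul_sub_of_deriv_le (convex_Icc (0:ℝ) 1)
    (f := fun t => ∫ x, h x * g (x - t • z)) (C := ‖z‖ * S)
    (fun t _ => (hder t).continuousAt.continuousWithinAt)
    (fun t _ => (hder t).differentiableAt.differentiableWithinAt)
    (fun t ht => by rw [(hder t).deriv]; exact hbound t (interior_subset ht)) 0 (by simp) 1 (by simp)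
    zero_le_one
  simp only [one_smul, zero_smul, sub_zero, mul_one] at hmv
  have e := integral_sub (hF1 1) (hF1 0)
  simp only [one_smul, zero_smul, sub_zero] at e
  simp_rw [mul_sub]
  rw [e]; exact hmv

lemma trans_le {h : Euc N → ℝ} (hf : Integrable h) (hm : Measurable h) {M : ℝ}
    (hM : ∀ x, |h x| ≤ M) {x₀ : Euc N} {r ρ : ℝ} {S : ℝ}
    (hV : VarLe h (ball x₀ r) S) {z : Euc N} (hr : ρ + ‖z‖ < r) :
    ∫ x in ball x₀ ρ, |h (x + z) - h x| ≤ ‖z‖ * S := by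
  apply le_of_forall_pos_le_add
  intro ε hε
  have hM0 : 0 ≤ M := (abs_nonneg _).trans (hM x₀)
  let d : Euc N → ℝ := fun x => h (x + z) - h x
  have hdm : Measurable d := by fun_prop
  have hdi : Integrable d := (hf.comp_add_right z).sub hf
  have hdM : ∀ x, |d x| ≤ 2 * M := fun x => by
    have := hM x; have := hM (x+z); 
    calc |d x| ≤ |h (x+z)| + |h x| := abs_sub _ _
      _ ≤ _ := by linarith
  let g : Euc N → ℝ := (ball x₀ ρ).indicator (fun x => if 0 ≤ d x then 1 else -1)
  have hgm : Measurable g := (Measurable.ite (measurableSet_le measurable_const hdm)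
    measurable_const measurable_const).indicator measurableSet_ball
  have hgb : ∀ x, |g x| ≤ 1 := by
    intro x
    simp only [g, indicator]
    split_ifs <;> simp
  have hg0 : ∀ x, x ∉ ball x₀ ρ → g x = 0 := fun x hx => indicator_of_notMem hx _
  have hgi : Integrable g := by
    refine Integrable.mono' (g := (ball x₀ ρ).indicator (fun _ => (1:ℝ))) ?_ hgm.aestronglyMeasurable (Eventually.of_forall ?_)
    · rw [integrable_indicator_iff measurableSet_ball]
      exact integrableOn_const (measure_ball_lt_top.ne)
    · intro x
      simp only [g, indicator, Real.norm_eq_abs]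
      split_ifs <;> simp
  have hdg : ∀ x, d x * g x = (ball x₀ ρ).indicator (fun x => |h (x + z) - h x|) x := by
    intro x
    simp only [g, indicator]
    split_ifs with h1 h2
    · rw [mul_one]; exact (abs_of_nonneg h2).symm
    · rw [mul_neg_one]; exact (abs_of_nonpos (not_le.1 h2).le).symm
    · simp
  rw [← integral_indicator measurableSet_ball]
  simp_rw [← hdg]
  obtain ⟨η, w, hw⟩ := exists_mol hgi hgm (r := (r - (ρ + ‖z‖)) / 2) (ε := ε / (2 * M + 1)) (by linarith) (by positivity)
  have hwb := hw.bdd hgb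
  have hw0 := hw.zero hg0
  have hsm := trans_smooth hf hV (ρ := ρ + (r - (ρ + ‖z‖)) / 2) (z := z) (by linarith)
    (hw.smooth.of_le (by exact_mod_cast le_top)) hwb hw0
  have hwc := hw.smooth.continuous
  have hdw : Integrable (fun x => d x * w x) :=
    hdi.mul_bdd hwc.aestronglyMeasurable (Eventually.of_forall fun x => hwb x)
  have hdgi : Integrable (fun x => d x * g x) :=
    hdi.mul_bdd hgm.aestronglyMeasurable (Eventually.of_forall fun x => hgb x)
  have e1 : ∫ x, d x * w x = ∫ x, h x * (w (x - z) - w x) := by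
    have i1 : Integrable (fun x => h (x + z) * w x) :=
      (hf.comp_add_right z).mul_bdd hwc.aestronglyMeasurable (Eventually.of_forall fun x => hwb x)
    have i2 : Integrable (fun x => h x * w x) :=
      hf.mul_bdd hwc.aestronglyMeasurable (Eventually.of_forall fun x => hwb x)
    have i3 : Integrable (fun x => h x * w (x - z)) :=
      hf.mul_bdd (by fun_prop) (Eventually.of_forall fun x => hwb _)
    simp only [d, sub_mul, mul_sub]
    rw [integral_sub i1 i2, integral_sub i3 i2]
    congr 1
    rw [← integral_add_right_eq_self (fun x => h x * w (x - z)) z]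
    simp
  have e2 : (∫ x, d x * g x) - ∫ x, d x * w x ≤ 2 * M * (ε / (2 * M + 1)) := by
    rw [← integral_sub hdgi hdw]
    calc ∫ x, (d x * g x - d x * w x) ≤ ∫ x, 2 * M * |w x - g x| := by
          apply integral_mono (hdgi.sub hdw) ((hw.integ.sub hgi).abs.const_mul _)
          intro x
          simp only [Pi.sub_apply]
          calc d x * g x - d x * w x ≤ |d x * (g x - w x)| := by rw [mul_sub]; exact le_abs_self _
            _ ≤ _ := by
              rw [abs_mul, abs_sub_comm (g x)]
              exact mul_le_mul_of_nonneg_right (hdM x) (abs_nonneg _)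
      _ ≤ _ := by
          rw [integral_const_mul]
          exact mul_le_mul_of_nonneg_left hw.close (by positivity)
  have e3 : 2 * M * (ε / (2 * M + 1)) ≤ ε := by
    rw [mul_div_assoc', div_le_iff₀ (by positivity)]
    nlinarith
  linarith

lemma avg_le {h : Euc N → ℝ} (hf : Integrable h) (hm : Measurable h) {M : ℝ}
    (h0 : ∀ x, 0 ≤ h x) (hM : ∀ x, h x ≤ M) {x : Euc N} {r ρ τ : ℝ} {S : ℝ}
    (hV : VarLe h (ball x r) S) (hr : ρ + τ ≤ r) {c : ℝ}
    (hc : ∀ y ∈ ball x ρ, c ≤ volume.real ({w | h w = 0} ∩ ball y τ)) :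
    c * ∫ y in ball x ρ, h y ≤ volume.real (ball (0 : Euc N) τ) * (τ * S) := by
  have hM' : ∀ x, |h x| ≤ M := fun x => by rw [abs_of_nonneg (h0 x)]; exact hM x
  let Z : Set (Euc N) := {w | h w = 0}
  have hZ : MeasurableSet Z := hm (measurableSet_singleton 0)
  let k : Euc N → ℝ := Z.indicator 1
  have hk : Measurable k := measurable_one.indicator hZ
  have hkb : ∀ x, |k x| ≤ 1 := fun x => by
    simp only [k, indicator]; split_ifs <;> simp
  have hk0 : ∀ x, 0 ≤ k x := fun x => by
    simp only [k, indicator]; split_ifs <;> simp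
  have i1 : Integrable (fun p : Euc N × Euc N => h p.1 * k (p.1 + p.2))
      ((volume.restrict (ball x ρ)).prod (volume.restrict (ball 0 τ))) := by
    have : IsFiniteMeasure (volume.restrict (ball (0:Euc N) τ)) := 
      ⟨by rw [Measure.restrict_apply_univ]; exact measure_ball_lt_top⟩
    have : Integrable (fun p : Euc N × Euc N => h p.1)
      ((volume.restrict (ball x ρ)).prod (volume.restrict (ball 0 τ))) :=
      hf.restrict.comp_fst _
    refine this.mul_bdd (c := 1) ?_ (Eventually.of_forall fun p => hkb _)
    exact (hk.comp (measurable_fst.add measurable_snd)).aestronglyMeasurable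
  have hsw := integral_integral_swap (f := fun y z => h y * k (y + z)) i1
  have lower : c * ∫ y in ball x ρ, h y ≤ ∫ y in ball x ρ, ∫ z in ball 0 τ, h y * k (y + z) := by
    rw [← integral_const_mul]
    apply setIntegral_mono_on (hf.restrict.const_mul c) i1.integral_prod_left measurableSet_ball
    intro y hy
    show c * h y ≤ ∫ z in ball 0 τ, h y * k (y + z)
    rw [integral_const_mul, mul_comm]
    apply mul_le_mul_of_nonneg_left _ (h0 y)
    refine (hc y hy).trans (le_of_eq ?_)
    rw [← integral_indicator measurableSet_ball]
    have e : ∀ z, (ball (0:Euc N) τ).indicator (fun z => k (y + z)) z =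
        (Z ∩ ball y τ).indicator 1 (z + y) := by
      intro z
      have : z ∈ ball (0:Euc N) τ ↔ z + y ∈ ball y τ := by
        simp [dist_eq_norm]
      by_cases h1 : z + y ∈ ball y τ
      · rw [indicator_of_mem (this.2 h1)]
        simp only [k, add_comm y z]
        by_cases h2 : z + y ∈ Z
        · rw [indicator_of_mem h2, indicator_of_mem (show z + y ∈ Z ∩ ball y τ from ⟨h2, h1⟩)]
        · rw [indicator_of_notMem h2, indicator_of_notMem (fun h => h2 h.1)]
      · rw [indicator_of_notMem (fun h => h1 (this.1 h)), indicator_of_notMem (fun h => h1 h.2)]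
    simp_rw [e]
    rw [integral_add_right_eq_self (fun z => (Z ∩ ball y τ).indicator (1 : Euc N → ℝ) z)]
    rw [integral_indicator_one (hZ.inter measurableSet_ball)]
  refine lower.trans ?_
  rw [hsw]
  have hS := hV.nonneg
  calc ∫ z in ball 0 τ, ∫ y in ball x ρ, h y * k (y + z)
      ≤ ∫ z in ball (0:Euc N) τ, τ * S := by
        apply setIntegral_mono_on i1.integral_prod_right (integrableOn_const measure_ball_lt_top.ne)
          measurableSet_ball
        intro z hz
        rw [mem_ball_zero_iff] at hz
        have := trans_le hf hm hM' hV (z := z) (ρ := ρ) (by linarith)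
        refine le_trans (le_trans ?_ this) (mul_le_mul_of_nonneg_right hz.le hS)
        apply setIntegral_mono
        · exact hf.restrict.mul_bdd (c := 1) (by exact (hk.comp (by fun_prop)).aestronglyMeasurable)
            (Eventually.of_forall fun p => hkb _)
        · exact ((hf.comp_add_right z).sub hf).abs.restrict
        · intro y
          simp only [k, indicator]
          split_ifs with h2
          · have : h (y + z) = 0 := h2
            simp [this, abs_of_nonneg (h0 y)]
          · simp
    _ = _ := by
        rw [setIntegral_const, smul_eq_mul]

lemma vball (x : Euc N) {r : ℝ} (hr : 0 < r) :
    volume.real (ball x r) = r ^ N * volume.real (ball (0 : Euc N) 1) := by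
  have := Measure.addHaar_ball_of_pos (volume : Measure (Euc N)) x hr
  rw [finrank_euclideanSpace, Fintype.card_fin] at this
  rw [measureReal_def, this, ENNReal.toReal_mul, ENNReal.toReal_ofReal (by positivity),
    measureReal_def]

lemma omega_pos : 0 < volume.real (ball (0 : Euc N) 1) :=
  ENNReal.toReal_pos (measure_ball_pos _ _ one_pos).ne' measure_ball_lt_top.ne

/-- Poincare type inequality for functions with small support -/
lemma poinc {h : Euc N → ℝ} (hf : Integrable h) (hm : Measurable h) {M : ℝ}
    (h0 : ∀ x, 0 ≤ h x) (hM : ∀ x, h x ≤ M) {x : Euc N} {ρ ε : ℝ} (hρ : 0 < ρ) (hε : 0 < ε)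
    (hε1 : ε ≤ 1) {S : ℝ} (hV : VarLe h (ball x (2 * ρ)) S)
    (hs : volume.real ({w | 0 < h w} ∩ ball x (2 * ρ)) ≤ 1/2 * volume.real (ball (0 : Euc N) (ε * ρ))) :
    ∫ y in ball x ρ, h y ≤ 2 * ε * ρ * S := by
  have hερ : 0 < ε * ρ := by positivity
  have hle : ε * ρ ≤ ρ := mul_le_of_le_one_left hρ.le hε1
  have := avg_le hf hm h0 hM hV (ρ := ρ) (τ := ε * ρ) (c := 1/2 * volume.real (ball (0 : Euc N) (ε * ρ)))
    (by linarith) ?_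
  · have hp : 0 < volume.real (ball (0 : Euc N) (ε * ρ)) := by
      rw [vball _ hερ]; exact mul_pos (by positivity) omega_pos
    have : volume.real (ball (0 : Euc N) (ε * ρ)) * (1/2 * ∫ y in ball x ρ, h y) ≤
       volume.real (ball (0 : Euc N) (ε * ρ)) * (ε * ρ * S) := by linarith
    have := le_of_mul_le_mul_left this hp
    linarith
  · intro y hy
    have e : volume.real (ball (0 : Euc N) (ε * ρ)) = volume.real (ball y (ε * ρ)) := by
      rw [vball _ hερ, vball _ hερ]
    have hsub : ball y (ε * ρ) ⊆ ({w | h w = 0} ∩ ball y (ε * ρ)) ∪ ({w | 0 < h w} ∩ ball x (2 * ρ)) := by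
      intro w hw
      rcases (h0 w).eq_or_lt with h | h
      · exact Or.inl ⟨h.symm, hw⟩
      · refine Or.inr ⟨h, ?_⟩
        rw [mem_ball] at *
        linarith [dist_triangle w y x]
    have h1 := measureReal_mono hsub (μ := volume)
      ((measure_union_lt_top ((measure_mono inter_subset_right).trans_lt measure_ball_lt_top)
      ((measure_mono inter_subset_right).trans_lt measure_ball_lt_top)).ne)
    have h2 := measureReal_union_le (μ := volume) ({w | h w = 0} ∩ ball y (ε * ρ)) ({w | 0 < h w} ∩ ball x (2 * ρ))
    linarith

/-- relative isoperimetric inequality -/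
lemma isop {E : Set (Euc N)} (hE : MeasurableSet E) (hfin : volume E < ⊤) {x : Euc N} {ρ S : ℝ}
    (hρ : 0 < ρ) (hV : VarLe (E.indicator 1) (ball x (4 * ρ)) S) :
    volume.real (ball x ρ \ E) * volume.real (E ∩ ball x ρ) ≤ 
      volume.real (ball (0 : Euc N) (2 * ρ)) * (2 * ρ * S) := by
  have := avg_le (h := E.indicator 1) (M := 1) ?_ (measurable_one.indicator hE) 
    (fun x => by simp only [indicator]; split_ifs <;> simp)
    (fun x => by simp only [indicator]; split_ifs <;> simp) (x := x) (ρ := ρ) (τ := 2 * ρ) hV (by linarith)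
    (c := volume.real (ball x ρ \ E)) ?_
  · convert this using 2
    rw [integral_indicator_one hE, measureReal_restrict_apply hE]
  · exact (integrable_indicator_iff hE).2 (integrableOn_const hfin.ne)
  · intro y hy
    apply measureReal_mono _ ((measure_mono inter_subset_right).trans_lt measure_ball_lt_top).ne
    intro w hw
    refine ⟨by simp [hw.2], ?_⟩
    have := hw.1
    rw [mem_ball] at *
    linarith [dist_triangle_right w y x]

/-- Hausdorff premeasure of dimension N-1 -/
def hpre (N : ℕ) (δ : ℝ≥0∞) : OuterMeasure (Euc N) :=
  OuterMeasure.mkMetric'.pre (fun s => ediam s ^ ((N : ℝ) - 1)) δ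

lemma hausdorff_null {A : Set (Euc N)} (h : ∀ δ : ℝ, 0 < δ → hpre N (ENNReal.ofReal δ) A = 0) :
    (μH[(N : ℝ) - 1] : Measure (Euc N)) A = 0 := by
  have e : (μH[(N : ℝ) - 1] : Measure (Euc N)) A =
      OuterMeasure.mkMetric (fun r => r ^ ((N : ℝ) - 1)) A := by
    rw [OuterMeasure.coe_mkMetric]; rfl
  rw [e]
  unfold OuterMeasure.mkMetric OuterMeasure.mkMetric'
  simp only [OuterMeasure.iSup_apply, ENNReal.iSup_eq_zero]
  intro δ hδ
  rcases eq_or_ne δ ⊤ with rfl | hδ'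
  · have := h 1 one_pos
    refine le_antisymm (le_trans ?_ this.le) zero_le
    exact OuterMeasure.mkMetric'.mono_pre _ le_top A
  · have := h δ.toReal (ENNReal.toReal_pos hδ.ne' hδ')
    rwa [ENNReal.ofReal_toReal hδ'] at this

lemma hpre_mono {δ δ' : ℝ≥0∞} (h : δ ≤ δ') (A : Set (Euc N)) : hpre N δ' A ≤ hpre N δ A :=
  OuterMeasure.mkMetric'.mono_pre _ h A

lemma hpre_closedBall (hN : 1 ≤ N) {δ : ℝ≥0∞} (x : Euc N) {r : ℝ} (hr : 0 ≤ r)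
    (hδ : ENNReal.ofReal (2 * r) ≤ δ) :
    hpre N δ (closedBall x r) ≤ ENNReal.ofReal ((2 * r) ^ (N - 1)) := by
  have hd : ediam (closedBall x r) ≤ ENNReal.ofReal (2 * r) := by
    apply ediam_le
    intro y hy z hz
    rw [edist_dist]
    apply ENNReal.ofReal_le_ofReal
    rw [mem_closedBall] at hy hz
    linarith [dist_triangle_right y z x]
  have h1 : hpre N δ (closedBall x r) ≤ ediam (closedBall x r) ^ ((N : ℝ) - 1) :=
    OuterMeasure.mkMetric'.pre_le (hd.trans hδ)
  refine h1.trans ?_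
  have e : ((N : ℝ) - 1) = ((N - 1 : ℕ) : ℝ) := by rw [Nat.cast_sub hN]; simp
  rw [e, ENNReal.rpow_natCast, ENNReal.ofReal_pow (by positivity)]
  gcongr

lemma pre_vitali (hN : 1 ≤ N) {A : Set (Euc N)} {r : Euc N → ℝ} {R : ℝ}
    (hr : ∀ x ∈ A, 0 < r x ∧ r x ≤ R) {M : ℝ}
    (hfin : ∀ s : Finset (Euc N), (s : Set (Euc N)) ⊆ A →
      (s : Set (Euc N)).PairwiseDisjoint (fun x => closedBall x (r x)) →
      ∑ x ∈ s, r x ^ (N - 1) ≤ M) :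
    hpre N (ENNReal.ofReal (10 * R)) A ≤ ENNReal.ofReal (10 ^ (N - 1) * M) := by
  obtain ⟨u, huA, hud, hcov⟩ := Vitali.exists_disjoint_subfamily_covering_enlargement_closedBall
    A id r R (fun a ha => (hr a ha).2) 5 (by norm_num)
  have hc : u.Countable := by
    apply hud.countable_of_nonempty_interior
    intro x hx
    exact ⟨x, ball_subset_interior_closedBall (mem_ball_self (hr x (huA hx)).1)⟩
  have hsub : A ⊆ ⋃ b ∈ u, closedBall b (5 * r b) := by
    intro x hx
    obtain ⟨b, hb, hb'⟩ := hcov x hx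
    exact mem_biUnion hb (hb' (mem_closedBall_self (hr x hx).1.le))
  refine (measure_mono hsub).trans ((measure_biUnion_le _ hc _).trans ?_)
  rw [ENNReal.tsum_eq_iSup_sum]
  apply iSup_le
  intro s
  calc ∑ b ∈ s, hpre N (ENNReal.ofReal (10 * R)) (closedBall (b : Euc N) (5 * r b))
      ≤ ∑ b ∈ s, ENNReal.ofReal (10 ^ (N - 1) * r b ^ (N - 1)) := by
        apply Finset.sum_le_sum
        intro b _
        have := hr b (huA b.2)
        refine (hpre_closedBall hN _ (by linarith) (ENNReal.ofReal_le_ofReal (by linarith))).trans ?_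
        rw [← mul_pow]
        apply le_of_eq; congr 2; ring
    _ = ENNReal.ofReal (10 ^ (N - 1) * ∑ b ∈ s, r b ^ (N - 1)) := by
        rw [Finset.mul_sum, ENNReal.ofReal_sum_of_nonneg]
        intro b _
        have := (hr b (huA b.2)).1
        positivity
    _ ≤ _ := by
        apply ENNReal.ofReal_le_ofReal
        apply mul_le_mul_of_nonneg_left _ (by positivity)
        have hi : Function.Injective (Subtype.val : u → Euc N) := Subtype.val_injective
        have := hfin (s.map ⟨Subtype.val, hi⟩) ?_ ?_
        · simpa using this
        · intro x hx
          simp only [Finset.coe_map, Function.Embedding.coeFn_mk, mem_image] at hx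
          obtain ⟨y, _, rfl⟩ := hx
          exact huA y.2
        · apply hud.subset
          intro x hx
          simp only [Finset.coe_map, Function.Embedding.coeFn_mk, mem_image] at hx
          obtain ⟨y, _, rfl⟩ := hx
          exact y.2

lemma borel_cantelli {A : ℕ → Set (Euc N)} {δ : ℕ → ℝ} (hδ : Tendsto δ atTop (𝓝 0))
    {M : ℕ → ℝ≥0∞} (hM : ∑' j, M j ≠ ⊤) (h : ∀ j, hpre N (ENNReal.ofReal (δ j)) (A j) ≤ M j) :
    (μH[(N : ℝ) - 1] : Measure (Euc N)) {x | ∃ᶠ j in atTop, x ∈ A j} = 0 := by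
  apply hausdorff_null
  intro d hd
  obtain ⟨n, hn⟩ := eventually_atTop.1 (hδ.eventually (gt_mem_nhds hd))
  have h2 : ∑' j, hpre N (ENNReal.ofReal d) (A (j + n)) ≠ ⊤ := by
    refine ne_top_of_le_ne_top hM ?_
    calc ∑' j, hpre N (ENNReal.ofReal d) (A (j + n)) ≤ ∑' j, M (j + n) := by
          apply ENNReal.tsum_le_tsum
          intro j
          exact (hpre_mono (ENNReal.ofReal_le_ofReal (hn (j + n) (by omega)).le) _).trans (h _)
      _ ≤ _ := ENNReal.tsum_comp_le_tsum_of_injective (add_left_injective n) _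
  have := measure_limsup_atTop_eq_zero h2
  refine le_antisymm (le_trans (measure_mono ?_) this.le) zero_le
  intro x hx
  rw [mem_limsup_iff_frequently_mem]
  rw [mem_ofPred_eq, frequently_atTop] at hx
  rw [frequently_atTop]
  intro a
  obtain ⟨b, hb, hb'⟩ := hx (a + n)
  exact ⟨b - n, by omega, by rwa [Nat.sub_add_cancel (by omega)]⟩

lemma testVF_sum {ι : Type*} (s : Finset ι) {ψ : ι → Euc N → Euc N} {K : ι → Set (Euc N)}
    {U : Set (Euc N)} (hd : (s : Set ι).PairwiseDisjoint K) (hψ : ∀ i ∈ s, ψ i ∈ TestVF (K i))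
    (hU : ∀ i ∈ s, K i ⊆ U) : (fun y => ∑ i ∈ s, ψ i y) ∈ TestVF U := by
  have hz : ∀ i ∈ s, ∀ y, y ∉ K i → ψ i y = 0 := fun i hi y hy =>
    image_eq_zero_of_notMem_tsupport (fun h => hy ((hψ i hi).2.2.1 h))
  have hsub : tsupport (fun y => ∑ i ∈ s, ψ i y) ⊆ ⋃ i ∈ s, tsupport (ψ i) := by
    apply closure_minimal
    · intro y hy
      by_contra hy'
      apply hy
      apply Finset.sum_eq_zero
      intro i hi
      apply image_eq_zero_of_notMem_tsupport
      intro h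
      exact hy' (mem_biUnion hi h)
    · exact s.finite_toSet.isClosed_biUnion fun i _ => isClosed_tsupport _
  refine ⟨ContDiff.sum fun i hi => (hψ i hi).1, ?_, ?_, ?_⟩
  · have : IsCompact (⋃ i ∈ s, tsupport (ψ i)) :=
      s.finite_toSet.isCompact_biUnion fun i hi => (hψ i hi).2.1
    exact this.of_isClosed_subset (isClosed_tsupport _) hsub
  · refine hsub.trans (iUnion₂_subset fun i hi => ?_)
    exact ((hψ i hi).2.2.1).trans (hU i hi)
  · intro y
    show ‖∑ i ∈ s, ψ i y‖ ≤ 1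
    by_cases h : ∃ i ∈ s, y ∈ K i
    · obtain ⟨i, hi, hy⟩ := h
      rw [Finset.sum_eq_single i]
      · exact (hψ i hi).2.2.2 y
      · intro j hj hji
        apply hz j hj
        intro hy'
        exact (hd hj hi hji).le_bot ⟨hy', hy⟩
      · intro h; exact absurd hi h
    · push Not at h
      rw [Finset.sum_eq_zero fun i hi => hz i hi y (h i hi)]
      simp

lemma sum_test {ι : Type*} (s : Finset ι) {ψ : ι → Euc N → Euc N} {h : Euc N → ℝ}
    (hh : Integrable h) (hψ : ∀ i ∈ s, ContDiff ℝ 1 (ψ i) ∧ HasCompactSupport (ψ i)) :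
    ∫ x, h x * diverg (fun y => ∑ i ∈ s, ψ i y) x = ∑ i ∈ s, ∫ x, h x * diverg (ψ i) x := by
  rw [← integral_finsetSum s fun i hi => int_mul_diverg hh (hψ i hi).1 (hψ i hi).2]
  congr 1; ext x
  rw [diverg_sum s fun i hi => (hψ i hi).1, Finset.mul_sum]

/-- the stopping radius -/
lemma stopping_radius {E : Set (Euc N)} (hfin : volume E < ⊤) {σ R : ℝ} (hσ : 0 < σ)
    (hvol : volume.real E ≤ σ * volume.real (ball (0 : Euc N) (R / 2))) {x : Euc N} {ρ₀ : ℝ}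
    (h0 : 0 < ρ₀) (hR : 0 < R)
    (hd : σ * volume.real (ball x ρ₀) < volume.real (E ∩ ball x ρ₀)) :
    ∃ ρ, 0 < ρ ∧ ρ ≤ R ∧ volume.real (E ∩ ball x ρ) ≤ σ * volume.real (ball x ρ) ∧
      σ * volume.real (ball x (ρ / 2)) ≤ volume.real (E ∩ ball x ρ) := by
  classical
  let P : ℕ → Prop := fun j => volume.real (E ∩ ball x (2 ^ j * ρ₀)) ≤ σ * volume.real (ball x (2 ^ j * ρ₀))
  have hω := omega_pos (N := N)
  have big : ∀ j, R / 2 ≤ 2 ^ j * ρ₀ → P j := by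
    intro j hj
    calc volume.real (E ∩ ball x (2 ^ j * ρ₀)) ≤ volume.real E :=
          measureReal_mono inter_subset_left hfin.ne
      _ ≤ _ := hvol
      _ ≤ _ := by
        rw [vball (0 : Euc N) (half_pos hR), vball x (r := 2 ^ j * ρ₀) (by positivity)]
        gcongr
  have hex : ∃ j, P j := by
    obtain ⟨j, hj⟩ := pow_unbounded_of_one_lt (R / 2 / ρ₀) (one_lt_two)
    refine ⟨j, big j ?_⟩
    rw [div_lt_iff₀ h0] at hj
    exact hj.le
  have hne : Nat.find hex ≠ 0 := by
    intro h
    have := Nat.find_spec hex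
    rw [h] at this
    simp only [P, pow_zero, one_mul] at this
    linarith
  obtain ⟨k, hk⟩ := Nat.exists_eq_succ_of_ne_zero hne
  have hkP : ¬ P k := Nat.find_min hex (by omega)
  have hP := Nat.find_spec hex
  rw [hk] at hP
  have hlt : 2 ^ k * ρ₀ < R / 2 := by
    by_contra h
    exact hkP (big k (not_lt.1 h))
  have he : (2:ℝ) ^ (k + 1) * ρ₀ / 2 = 2 ^ k * ρ₀ := by rw [pow_succ]; ring
  refine ⟨2 ^ (k + 1) * ρ₀, by positivity, by linarith, hP, ?_⟩
  rw [he]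
  refine (not_le.1 hkP).le.trans ?_
  apply measureReal_mono _ ((measure_mono inter_subset_right).trans_lt measure_ball_lt_top).ne
  apply inter_subset_inter_right
  apply ball_subset_ball
  rw [← he]; linarith [show 0 < 2 ^ (k+1) * ρ₀ by positivity]

lemma stopping_var {E : Set (Euc N)} (hN : 1 ≤ N) (hE : MeasurableSet E) (hfin : volume E < ⊤) {σ : ℝ}
    (hσ : 0 < σ) (hσ2 : σ ≤ 1/2) {x : Euc N} {ρ : ℝ} (hρ : 0 < ρ)
    (h1 : volume.real (E ∩ ball x ρ) ≤ σ * volume.real (ball x ρ))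
    (h2 : σ * volume.real (ball x (ρ / 2)) ≤ volume.real (E ∩ ball x ρ)) :
    ¬ VarLe (E.indicator 1) (ball x (4 * ρ))
      (σ * volume.real (ball (0 : Euc N) 1) / (8 * 4 ^ N) * ρ ^ (N - 1)) := by
  intro hV
  have := isop hE hfin hρ hV
  have hω := omega_pos (N := N)
  set ω := volume.real (ball (0 : Euc N) 1)
  have hBE : 1 / 2 * (ρ ^ N * ω) ≤ volume.real (ball x ρ \ E) := by
    have e1 : volume.real (E ∩ ball x ρ) + volume.real (ball x ρ \ E) = volume.real (ball x ρ) := by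
      rw [inter_comm]
      exact measureReal_inter_add_sdiff hE (h := measure_ball_lt_top.ne)
    rw [vball _ hρ] at e1 h1
    have : σ * (ρ ^ N * ω) ≤ 1 / 2 * (ρ ^ N * ω) := mul_le_mul_of_nonneg_right hσ2 (by positivity)
    linarith
  rw [vball _ (half_pos hρ)] at h2
  rw [vball _ (by linarith)] at this
  have h3 : 1 / 2 * (ρ ^ N * ω) * (σ * ((ρ/2) ^ N * ω)) ≤
      (2 * ρ) ^ N * ω * (2 * ρ * (σ * ω / (8 * 4 ^ N) * ρ ^ (N - 1))) :=
    le_trans (mul_le_mul hBE h2 (by positivity) measureReal_nonneg) this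
  have e : ρ * ρ ^ (N - 1) = ρ ^ N := by
    rw [← pow_succ']; congr 1; omega
  have e4 : (4:ℝ) ^ N = 2 ^ N * 2 ^ N := by rw [← mul_pow]; norm_num
  have l : 1 / 2 * (ρ ^ N * ω) * (σ * ((ρ/2) ^ N * ω)) = 1 / 2 * (ρ ^ N * ρ ^ N * ω * ω * σ / 2 ^ N) := by
    rw [div_pow]; ring
  have r : (2 * ρ) ^ N * ω * (2 * ρ * (σ * ω / (8 * 4 ^ N) * ρ ^ (N - 1))) =
     1 / 4 * (ρ ^ N * ρ ^ N * ω * ω * σ / 2 ^ N) := by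
    rw [mul_pow, e4, ← e]
    field_simp
    ring
  rw [l, r] at h3
  have : 0 < ρ ^ N * ρ ^ N * ω * ω * σ / 2 ^ N := by positivity
  linarith

lemma boxing (hN : 1 ≤ N) {E U : Set (Euc N)} (hE : MeasurableSet E) (hfin : volume E < ⊤) {σ : ℝ}
    (hσ : 0 < σ) (hσ2 : σ ≤ 1/2) {S : ℝ} (hV : VarLe (E.indicator 1) U S) {R : ℝ} (hR : 0 < R)
    (hvol : volume.real E ≤ σ * volume.real (ball (0 : Euc N) (R / 2))) :
    hpre N (ENNReal.ofReal (40 * R)) {x | closedBall x (4 * R) ⊆ U ∧ ∃ ρ, 0 < ρ ∧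
      σ * volume.real (ball x ρ) < volume.real (E ∩ ball x ρ)} ≤
      ENNReal.ofReal (40 ^ (N - 1) * (8 * 4 ^ N) / (σ * volume.real (ball (0 : Euc N) 1)) * S) := by
  have hω := omega_pos (N := N)
  set ω := volume.real (ball (0 : Euc N) 1)
  set A := {x | closedBall x (4 * R) ⊆ U ∧ ∃ ρ, 0 < ρ ∧
      σ * volume.real (ball x ρ) < volume.real (E ∩ ball x ρ)}
  have hex : ∀ x : Euc N, ∃ ρ : ℝ, ∃ ψ : Euc N → Euc N, x ∈ A → (0 < ρ ∧ ρ ≤ R ∧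
      ψ ∈ TestVF (ball x (4 * ρ)) ∧
      σ * ω / (8 * 4 ^ N) * ρ ^ (N - 1) < ∫ y, (E.indicator 1) y * diverg ψ y) := by
    intro x
    by_cases hx : x ∈ A
    · obtain ⟨_, ρ₀, h0, hd⟩ := hx
      obtain ⟨ρ, a, b, c, d⟩ := stopping_radius hfin hσ hvol h0 hR hd
      have := stopping_var hN hE hfin hσ hσ2 a c d
      unfold VarLe at this
      push Not at this
      obtain ⟨ψ, e, f⟩ := this
      exact ⟨ρ, ψ, fun _ => ⟨a, b, e, f⟩⟩
    · exact ⟨0, 0, fun h => absurd h hx⟩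
  choose ρ ψ hρψ using hex
  have key := pre_vitali hN (A := A) (r := fun x => 4 * ρ x) (R := 4 * R)
    (M := 4 ^ (N - 1) * (8 * 4 ^ N / (σ * ω) * S)) 
    (fun x hx => ⟨by linarith [(hρψ x hx).1], by linarith [(hρψ x hx).2.1]⟩) ?_
  · have e1 : 10 * (4 * R) = 40 * R := by ring
    have e2 : (10:ℝ) ^ (N - 1) * (4 ^ (N - 1) * (8 * 4 ^ N / (σ * ω) * S)) =
      40 ^ (N - 1) * (8 * 4 ^ N) / (σ * ω) * S := by
      rw [← mul_assoc, ← mul_pow]; norm_num; ring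
    rwa [e1, e2] at key
  · intro s hs hd
    have htest := testVF_sum s (ψ := ψ) (K := fun x => ball x (4 * ρ x)) (U := U)
      (hd.mono fun x => ball_subset_closedBall) (fun x hx => (hρψ x (hs hx)).2.2.1) ?_
    · have h1 := hV _ htest
      rw [sum_test s (h := E.indicator 1) ((integrable_indicator_iff hE).2 (integrableOn_const hfin.ne))
        fun x hx => ⟨(hρψ x (hs hx)).2.2.1.1, (hρψ x (hs hx)).2.2.1.2.1⟩] at h1
      have h2 : ∑ x ∈ s, σ * ω / (8 * 4 ^ N) * ρ x ^ (N - 1) ≤ S :=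
        (Finset.sum_le_sum fun x hx => (hρψ x (hs hx)).2.2.2.le).trans h1
      rw [← Finset.mul_sum] at h2
      simp_rw [mul_pow]
      rw [← Finset.mul_sum]
      gcongr
      have h3 : ∑ x ∈ s, ρ x ^ (N - 1) = 8 * 4 ^ N / (σ * ω) * (σ * ω / (8 * 4 ^ N) * ∑ x ∈ s, ρ x ^ (N - 1)) := by
        field_simp
      rw [h3]
      gcongr
    · intro x hx
      refine subset_trans (ball_subset_closedBall.trans (closedBall_subset_closedBall ?_)) (hs hx).1
      linarith [(hρψ x (hs hx)).2.1]

/-- a cut-off function for the ball of radius ρ around x -/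
structure Cut (C : ℝ) (x : Euc N) (ρ : ℝ) (ζ : Euc N → ℝ) : Prop where
  smooth : ContDiff ℝ 1 ζ
  nonneg : ∀ y, 0 ≤ ζ y
  le_one : ∀ y, ζ y ≤ 1
  one : ∀ y ∈ ball x (2 * ρ), ζ y = 1
  zero : ∀ y, y ∉ ball x (3 * ρ) → ζ y = 0
  deriv : ∀ y, ‖fderiv ℝ ζ y‖ ≤ C / ρ

lemma exists_cut (N : ℕ) : ∃ C : ℝ, 0 ≤ C ∧ ∀ (x : Euc N) (ρ : ℝ), 0 < ρ → ∃ ζ, Cut C x ρ ζ := by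
  let b : ContDiffBump (0 : Euc N) := ⟨2, 3, by norm_num, by norm_num⟩
  have hb : ContDiff ℝ 1 b := b.contDiff
  obtain ⟨C, hC⟩ := (b.hasCompactSupport.fderiv (𝕜 := ℝ)).exists_bound_of_continuous
    (hb.continuous_fderiv (by norm_num))
  refine ⟨C, (norm_nonneg _).trans (hC 0), fun x ρ hρ => ⟨fun y => b (ρ⁻¹ • (y - x)), ?_⟩⟩
  have hn : ∀ y, dist (ρ⁻¹ • (y - x)) 0 = dist y x / ρ := by
    intro y
    rw [dist_zero_right, norm_smul, norm_inv, Real.norm_eq_abs, abs_of_pos hρ, dist_eq_norm]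
    field_simp
  refine ⟨?_, fun y => b.nonneg, fun y => b.le_one, ?_, ?_, ?_⟩
  · exact hb.comp (by fun_prop : ContDiff ℝ 1 fun y : Euc N => ρ⁻¹ • (y - x))
  · intro y hy
    apply b.one_of_mem_closedBall
    rw [mem_closedBall, hn, div_le_iff₀ hρ]
    exact (mem_ball.1 hy).le
  · intro y hy
    apply b.zero_of_le_dist
    rw [hn, le_div_iff₀ hρ]
    exact not_lt.1 hy
  · intro y
    have h1 : HasFDerivAt (fun y : Euc N => ρ⁻¹ • (y - x)) (ρ⁻¹ • ContinuousLinearMap.id ℝ (Euc N)) y :=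
      ((hasFDerivAt_id y).sub_const x).const_smul ρ⁻¹
    have h2 := ((hb.differentiable (by norm_num)) (ρ⁻¹ • (y - x))).hasFDerivAt.comp y h1
    have h3 : fderiv ℝ (fun y => b (ρ⁻¹ • (y - x))) y = _ := h2.fderiv
    rw [h3]
    refine (ContinuousLinearMap.opNorm_comp_le _ _).trans ?_
    rw [div_eq_mul_inv]
    apply mul_le_mul (hC _) _ (norm_nonneg _) ((norm_nonneg _).trans (hC 0))
    rw [norm_smul, norm_inv, Real.norm_eq_abs, abs_of_pos hρ]
    exact mul_le_of_le_one_right (by positivity) ContinuousLinearMap.norm_id_le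

lemma select {I : ℝ → ℝ} {c τ δ : ℝ} (hτ : 0 < τ) (hδ : 0 < δ)
    (hc : ∀ ρ, 0 < ρ → I ρ ≤ c * ρ ^ N)
    (hf : ∃ᶠ ρ in 𝓝[>] (0:ℝ), τ * ρ ^ N < I ρ) :
    ∃ ρ, 0 < ρ ∧ ρ < δ ∧ τ * ρ ^ N < I ρ ∧ I (4 * ρ) ≤ 4 ^ (N + 1) * I ρ := by
  by_contra hcon
  push Not at hcon
  obtain ⟨k, hk⟩ := pow_unbounded_of_one_lt (c / τ) (show (1:ℝ) < 4 by norm_num)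
  rw [div_lt_iff₀ hτ] at hk
  have hev : ∀ᶠ ρ in 𝓝[>] (0:ℝ), 0 < ρ ∧ ρ < δ / 4 ^ k := by
    have : Ioo 0 (δ / 4 ^ k) ∈ 𝓝[>] (0:ℝ) := Ioo_mem_nhdsGT (by positivity)
    exact this
  obtain ⟨ρ, hρI, hρ, hρδ⟩ := (hf.and_eventually hev).exists
  rw [lt_div_iff₀ (by positivity)] at hρδ
  have claim : ∀ j ≤ k, 4 ^ j * τ * (4 ^ j * ρ) ^ N < I (4 ^ j * ρ) := by
    intro j
    induction j with
    | zero => intro _; simpa using hρI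
    | succ j ih =>
      intro hj
      have ih := ih (by omega)
      have h1 : (1:ℝ) ≤ 4 ^ j := one_le_pow₀ (by norm_num)
      have h2 : (4:ℝ) ^ j * ρ < δ := by
        refine lt_of_le_of_lt ?_ hρδ
        rw [mul_comm]
        gcongr
        · norm_num
        · omega
      have h3 : τ * (4 ^ j * ρ) ^ N < I (4 ^ j * ρ) := by
        refine lt_of_le_of_lt ?_ ih
        gcongr
        exact le_mul_of_one_le_left hτ.le h1
      have h4 := hcon (4 ^ j * ρ) (by positivity) h2 h3
      have e : (4:ℝ) ^ (j + 1) * ρ = 4 * (4 ^ j * ρ) := by rw [pow_succ]; ring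
      rw [e]
      refine lt_of_le_of_lt (le_of_eq ?_) ((mul_lt_mul_of_pos_left ih (show (0:ℝ) < 4 ^ (N+1) by positivity)).trans h4)
      rw [mul_pow 4 (4 ^ j * ρ) N]
      ring
  have h5 := (claim k le_rfl).trans_le (hc _ (by positivity))
  have h6 := lt_of_mul_lt_mul_right h5 (by positivity)
  linarith

lemma test_modify {U : Set (Euc N)} {φ : Euc N → Euc N} (hφ : φ ∈ TestVF U) (s : Finset (Euc N))
    {ρ : Euc N → ℝ} {C : ℝ} {ζ : Euc N → Euc N → ℝ} {ψ : Euc N → Euc N → Euc N}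
    (hρ : ∀ x ∈ s, 0 < ρ x)
    (hd : (s : Set (Euc N)).PairwiseDisjoint fun x => closedBall x (4 * ρ x))
    (hU : ∀ x ∈ s, closedBall x (4 * ρ x) ⊆ U) (hζ : ∀ x ∈ s, Cut C x (ρ x) (ζ x))
    (hψ : ∀ x ∈ s, ψ x ∈ TestVF (ball x (2 * ρ x))) :
    (fun y => φ y + ∑ x ∈ s, (ψ x y - ζ x y • φ y)) ∈ TestVF U := by
  have hz : ∀ x ∈ s, ∀ y, y ∉ ball x (3 * ρ x) → ψ x y - ζ x y • φ y = 0 := by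
    intro x hx y hy
    have h1 : y ∉ ball x (2 * ρ x) := fun h => hy (ball_subset_ball (by linarith [hρ x hx]) h)
    rw [(hζ x hx).zero y hy, image_eq_zero_of_notMem_tsupport (fun h => h1 ((hψ x hx).2.2.1 h))]
    simp
  let K := tsupport φ ∪ ⋃ x ∈ s, closedBall x (3 * ρ x)
  have hKc : IsCompact K :=
    hφ.2.1.isCompact.union (s.finite_toSet.isCompact_biUnion fun x _ => isCompact_closedBall _ _)
  have hsub : tsupport (fun y => φ y + ∑ x ∈ s, (ψ x y - ζ x y • φ y)) ⊆ K := by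
    apply closure_minimal _ hKc.isClosed
    intro y hy
    by_contra hy'
    apply hy
    have h1 : y ∉ tsupport φ := fun h => hy' (Or.inl h)
    show φ y + ∑ x ∈ s, (ψ x y - ζ x y • φ y) = 0
    rw [Finset.sum_eq_zero, add_zero, image_eq_zero_of_notMem_tsupport h1]
    intro x hx
    apply hz x hx
    intro h
    exact hy' (Or.inr (mem_biUnion hx (ball_subset_closedBall h)))
  refine ⟨?_, hKc.of_isClosed_subset (isClosed_tsupport _) hsub, hsub.trans ?_, ?_⟩
  · exact hφ.1.add (ContDiff.sum fun x hx => (hψ x hx).1.sub ((hζ x hx).smooth.smul hφ.1))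
  · refine union_subset hφ.2.2.1 (iUnion₂_subset fun x hx => ?_)
    exact (closedBall_subset_closedBall (by linarith [hρ x hx])).trans (hU x hx)
  · intro y
    show ‖φ y + ∑ x ∈ s, (ψ x y - ζ x y • φ y)‖ ≤ 1
    by_cases h : ∃ x ∈ s, y ∈ ball x (3 * ρ x)
    · obtain ⟨x, hx, hy⟩ := h
      have hs : ∑ x ∈ s, (ψ x y - ζ x y • φ y) = ψ x y - ζ x y • φ y := by
        apply Finset.sum_eq_single x
        · intro j hj hji
          apply hz j hj
          intro hy'
          have hdj : Disjoint (closedBall j (4 * ρ j)) (closedBall x (4 * ρ x)) := hd hj hx hji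
          exact Set.disjoint_left.1 hdj
            ((ball_subset_closedBall.trans (closedBall_subset_closedBall (by linarith [hρ j hj]))) hy')
            ((ball_subset_closedBall.trans (closedBall_subset_closedBall (by linarith [hρ x hx]))) hy)
        · intro h; exact absurd hx h
      rw [hs]
      by_cases h2 : y ∈ ball x (2 * ρ x)
      · rw [(hζ x hx).one y h2, one_smul, add_sub_cancel]
        exact (hψ x hx).2.2.2 y
      · rw [image_eq_zero_of_notMem_tsupport (fun h => h2 ((hψ x hx).2.2.1 h))]
        have e : φ y + (0 - ζ x y • φ y) = (1 - ζ x y) • φ y := by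
          rw [sub_smul, one_smul]; abel
        rw [e, norm_smul, Real.norm_eq_abs, abs_of_nonneg (by linarith [(hζ x hx).le_one y])]
        exact mul_le_one₀ (by linarith [(hζ x hx).nonneg y]) (norm_nonneg _) (hφ.2.2.2 y)
    · push Not at h
      rw [Finset.sum_eq_zero fun x hx => hz x hx y (h x hx), add_zero]
      exact hφ.2.2.2 y

lemma cut_bound {h : Euc N → ℝ} (hf : Integrable h) (h0 : ∀ x, 0 ≤ h x)
    {U : Set (Euc N)} {φ : Euc N → Euc N} (hφ : φ ∈ TestVF U) {Cφ : ℝ}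
    (hC : ∀ x, ‖diverg φ x‖ ≤ Cφ) {C : ℝ} {x : Euc N} {ρ : ℝ} (hρ : 0 < ρ) {ζ : Euc N → ℝ}
    (hζ : Cut C x ρ ζ) :
    ∫ y, h y * diverg (fun y => ζ y • φ y) y ≤ (Cφ + C / ρ) * ∫ y in ball x (4 * ρ), h y := by
  have hc : HasCompactSupport (fun y => ζ y • φ y) := 
    HasCompactSupport.intro hφ.2.1 (fun y hy => by
      rw [image_eq_zero_of_notMem_tsupport hy]; simp)
  have hsm := hζ.smooth.smul hφ.1
  rw [← integral_indicator measurableSet_ball, ← integral_const_mul]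
  apply integral_mono (int_mul_diverg hf hsm hc)
    (((integrable_indicator_iff measurableSet_ball).2 hf.restrict).const_mul _)
  intro y
  show h y * diverg (fun y => ζ y • φ y) y ≤ (Cφ + C / ρ) * (ball x (4 * ρ)).indicator h y
  by_cases hy : y ∈ ball x (4 * ρ)
  · rw [indicator_of_mem hy, mul_comm]
    apply mul_le_mul_of_nonneg_right _ (h0 y)
    rw [diverg_smul hζ.smooth hφ.1]
    apply add_le_add
    · calc ζ y * diverg φ y ≤ |ζ y * diverg φ y| := le_abs_self _
        _ ≤ 1 * Cφ := by
          rw [abs_mul, abs_of_nonneg (hζ.nonneg y)]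
          exact mul_le_mul (hζ.le_one y) (hC y) (abs_nonneg _) zero_le_one
        _ = Cφ := one_mul _
    · calc fderiv ℝ ζ y (φ y) ≤ ‖fderiv ℝ ζ y (φ y)‖ := Real.le_norm_self _
        _ ≤ ‖fderiv ℝ ζ y‖ * ‖φ y‖ := ContinuousLinearMap.le_opNorm _ _
        _ ≤ C / ρ * 1 := mul_le_mul (hζ.deriv y) (hφ.2.2.2 y) (norm_nonneg _)
              ((norm_nonneg _).trans (hζ.deriv y))
        _ = _ := mul_one _
  · rw [indicator_of_notMem hy, diverg_support, mul_zero, mul_zero]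
    have : tsupport (fun y => ζ y • φ y) ⊆ closedBall x (3 * ρ) := by
      apply closure_minimal _ isClosed_closedBall
      intro z hz
      by_contra hz'
      exact hz (by simp [hζ.zero z (fun h => hz' (ball_subset_closedBall h))])
    intro hy'
    exact hy (closedBall_subset_ball (by linarith) (this hy'))

lemma excess {f : Euc N → ℝ} (hf : Integrable f) (hm : Measurable f) {U : Set (Euc N)}
    (hU : IsOpen U) {V η : ℝ} (hV : VarLe f U V) {t : ℝ} (ht : 0 ≤ t) {φ : Euc N → Euc N}
    (hφ : φ ∈ TestVF U) (hη : V - η ≤ ∫ x, f x * diverg φ x) {Cφ : ℝ}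
    (hC : ∀ x, ‖diverg φ x‖ ≤ Cφ) (s : Finset (Euc N))
    {ρ : Euc N → ℝ} {C : ℝ} {ζ : Euc N → Euc N → ℝ} {ψ : Euc N → Euc N → Euc N}
    (hρ : ∀ x ∈ s, 0 < ρ x)
    (hd : (s : Set (Euc N)).PairwiseDisjoint fun x => closedBall x (4 * ρ x))
    (hsU : ∀ x ∈ s, closedBall x (4 * ρ x) ⊆ U) (hζ : ∀ x ∈ s, Cut C x (ρ x) (ζ x))
    (hψ : ∀ x ∈ s, ψ x ∈ TestVF (ball x (2 * ρ x))) :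
    ∑ x ∈ s, ∫ y, max (f y - t) 0 * diverg (ψ x) y ≤
      η + ∑ x ∈ s, (Cφ + C / ρ x) * ∫ y in ball x (4 * ρ x), max (f y - t) 0 := by
  have hi := int_pos hf ht
  have hcz : ∀ x, HasCompactSupport (fun y => ζ x y • φ y) := fun x =>
    HasCompactSupport.intro hφ.2.1 (fun y hy => by
      rw [image_eq_zero_of_notMem_tsupport hy]; simp)
  have hsm : ∀ x ∈ s, ContDiff ℝ 1 (fun y => ψ x y - ζ x y • φ y) := fun x hx =>
    (hψ x hx).1.sub ((hζ x hx).smooth.smul hφ.1)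
  have hsc : ∀ x ∈ s, HasCompactSupport (fun y => ψ x y - ζ x y • φ y) := fun x hx =>
    (hψ x hx).2.1.sub (hcz x)
  have key := split_pos hf hm hU hV ht (test_modify hφ s hρ hd hsU hζ hψ) hφ
  have e1 : ∫ y, max (f y - t) 0 * diverg (fun y => φ y + ∑ x ∈ s, (ψ x y - ζ x y • φ y)) y =
      (∫ y, max (f y - t) 0 * diverg φ y) +
      ∑ x ∈ s, ∫ y, max (f y - t) 0 * diverg (fun y => ψ x y - ζ x y • φ y) y := by
    rw [← sum_test s hi fun x hx => ⟨hsm x hx, hsc x hx⟩]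
    have hcs : HasCompactSupport (fun y => ∑ x ∈ s, (ψ x y - ζ x y • φ y)) := by
      let K := ⋃ x ∈ s, tsupport (fun y => ψ x y - ζ x y • φ y)
      have hKc : IsCompact K :=
        s.finite_toSet.isCompact_biUnion fun x hx => (hsc x hx).isCompact
      refine HasCompactSupport.intro hKc fun y hy => Finset.sum_eq_zero fun x hx => ?_
      have : y ∉ tsupport (fun y => ψ x y - ζ x y • φ y) := fun h => hy (mem_biUnion hx h)
      exact image_eq_zero_of_notMem_tsupport (f := fun y => ψ x y - ζ x y • φ y) this
    rw [← integral_add (int_mul_diverg hi hφ.1 hφ.2.1)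
      (int_mul_diverg hi (ContDiff.sum hsm) hcs)]
    congr 1; ext y
    rw [diverg_add hφ.1 (ContDiff.sum hsm)]; ring
  have e2 : ∫ y, (f y - max (f y - t) 0) * diverg φ y =
      (∫ y, f y * diverg φ y) - ∫ y, max (f y - t) 0 * diverg φ y := by
    rw [← integral_sub (int_mul_diverg hf hφ.1 hφ.2.1) (int_mul_diverg hi hφ.1 hφ.2.1)]
    congr 1; ext y; ring
  have e3 : ∀ x ∈ s, ∫ y, max (f y - t) 0 * diverg (fun y => ψ x y - ζ x y • φ y) y =
      (∫ y, max (f y - t) 0 * diverg (ψ x) y) -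
        ∫ y, max (f y - t) 0 * diverg (fun y => ζ x y • φ y) y := by
    intro x hx
    have hz : ContDiff ℝ 1 (fun y => ζ x y • φ y) := (hζ x hx).smooth.smul hφ.1
    rw [← integral_sub (int_mul_diverg hi (hψ x hx).1 (hψ x hx).2.1)
      (int_mul_diverg hi hz (hcz x))]
    congr 1; ext y
    have : diverg (fun y => ψ x y - ζ x y • φ y) y = diverg (ψ x) y + diverg (fun y => - (ζ x y • φ y)) y := by
      rw [← diverg_add (hψ x hx).1 hz.neg]
      simp only [sub_eq_add_neg]
    rw [this, diverg_neg]; ring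
  have e4 : ∀ x ∈ s, ∫ y, max (f y - t) 0 * diverg (fun y => ζ x y • φ y) y ≤
      (Cφ + C / ρ x) * ∫ y in ball x (4 * ρ x), max (f y - t) 0 := fun x hx =>
    cut_bound hi (fun _ => le_max_right _ _) hφ hC (hρ x hx) (hζ x hx)
  rw [e1, e2, Finset.sum_congr rfl e3, Finset.sum_sub_distrib] at key
  have := Finset.sum_le_sum e4
  linarith

lemma null_lemma (hN : 1 ≤ N) : ∃ σ : ℝ, 0 < σ ∧ σ ≤ 1/2 ∧ ∀ (f : Euc N → ℝ), Integrable f →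
    Measurable f → ∀ (c : ℝ), (∀ x, f x ≤ c) → ∀ (U : Set (Euc N)), IsOpen U →
    ∀ (S : ℝ), VarLe f U S → ∀ (t : ℝ), 0 ≤ t → ∀ τ : ℝ, 0 < τ →
    (μH[(N : ℝ) - 1] : Measure (Euc N)) {x | x ∈ U ∧ 
      (∀ᶠ ρ in 𝓝[>] (0:ℝ), volume.real ({y | t < f y} ∩ ball x ρ) ≤ σ * volume.real (ball x ρ)) ∧
      ∃ᶠ ρ in 𝓝[>] (0:ℝ), τ * ρ ^ N < ∫ y in ball x ρ, max (f y - t) 0} = 0 := by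
  obtain ⟨C, hC0, hcut⟩ := exists_cut N
  let K : ℝ := (C + 1) * 4 ^ (N + 1) + 1
  have hK : 1 ≤ K := by
    have : 0 ≤ (C + 1) * 4 ^ (N + 1) := by positivity
    simp only [K]; linarith
  have hK0 : 0 < K := by linarith
  let ε : ℝ := 1 / (4 * K)
  have hε : 0 < ε := by positivity
  have hε1 : ε ≤ 1 := by
    simp only [ε]
    rw [div_le_one (by positivity)]; linarith
  refine ⟨ε ^ N / 2 ^ (N + 1), by positivity, ?_, ?_⟩
  · have h1 : ε ^ N ≤ 1 := pow_le_one₀ hε.le hε1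
    have h2 : (1:ℝ) ≤ 2 ^ N := one_le_pow₀ (by norm_num)
    rw [div_le_iff₀ (by positivity), pow_succ]; linarith
  intro f hf hm c hc U hU S hV t ht τ hτ
  have hi := int_pos hf ht
  set A := {x | x ∈ U ∧ 
      (∀ᶠ ρ in 𝓝[>] (0:ℝ), volume.real ({y | t < f y} ∩ ball x ρ) ≤ ε ^ N / 2 ^ (N + 1) * volume.real (ball x ρ)) ∧
      ∃ᶠ ρ in 𝓝[>] (0:ℝ), τ * ρ ^ N < ∫ y in ball x ρ, max (f y - t) 0} with hA
  apply hausdorff_null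
  intro δ0 hδ0
  -- near-optimal field
  let T := (fun φ : Euc N → Euc N => ∫ x, f x * diverg φ x) '' TestVF U
  have hT1 : T.Nonempty := ⟨_, mem_image_of_mem _ (zero_mem_testVF U)⟩
  have hT2 : BddAbove T := ⟨S, by rintro _ ⟨φ, hφ, rfl⟩; exact hV φ hφ⟩
  have hVV : VarLe f U (sSup T) := fun φ hφ => le_csSup hT2 (mem_image_of_mem _ hφ)
  have main : ∀ η : ℝ, 0 < η → hpre N (ENNReal.ofReal δ0) A ≤
      ENNReal.ofReal (10 ^ (N - 1) * (4 ^ (N - 1) * (η / τ))) := by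
    intro η hη
    obtain ⟨_, ⟨φ, hφ, rfl⟩, hφη⟩ := exists_lt_of_lt_csSup hT1 (show sSup T - η < sSup T by linarith)
    obtain ⟨Cφ, hCφ⟩ := (diverg_compact hφ.2.1).exists_bound_of_continuous (diverg_continuous hφ.1)
    have hCφ0 : 0 ≤ Cφ := (norm_nonneg _).trans (hCφ 0)
    obtain ⟨δ, hδ, hδ1, hδ2⟩ : ∃ δ : ℝ, 0 < δ ∧ 40 * δ ≤ δ0 ∧ Cφ * δ ≤ 1 := by
      refine ⟨min (δ0 / 40) (1 / (Cφ + 1)), by positivity, ?_, ?_⟩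
      · linarith [min_le_left (δ0 / 40) (1 / (Cφ + 1))]
      · calc Cφ * min (δ0 / 40) (1 / (Cφ + 1)) ≤ Cφ * (1 / (Cφ + 1)) :=
              mul_le_mul_of_nonneg_left (min_le_right _ _) hCφ0
          _ ≤ 1 := by rw [mul_one_div, div_le_one (by positivity)]; linarith
    have hsel : ∀ x, ∃ ρ : ℝ, ∃ ψ : Euc N → Euc N, x ∈ A → 0 < ρ ∧ ρ ≤ δ ∧ closedBall x (4 * ρ) ⊆ U ∧
        τ * ρ ^ N < (∫ y in ball x ρ, max (f y - t) 0) ∧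
        (∫ y in ball x (4 * ρ), max (f y - t) 0) ≤ 4 ^ (N + 1) * (∫ y in ball x ρ, max (f y - t) 0) ∧
        ψ ∈ TestVF (ball x (2 * ρ)) ∧
        K * (∫ y in ball x ρ, max (f y - t) 0) / ρ ≤ ∫ y, max (f y - t) 0 * diverg ψ y := by
      intro x
      by_cases hx : x ∈ A
      swap
      · exact ⟨0, 0, fun h => absurd h hx⟩
      obtain ⟨hxU, hden, hfr⟩ := hx
      obtain ⟨d1, hd1, hd1'⟩ := Metric.isOpen_iff.1 hU x hxU
      obtain ⟨d2, hd2, hd2'⟩ := mem_nhdsGT_iff_exists_Ioo_subset.1 hden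
      have hd2 : 0 < d2 := hd2
      have hbd : ∀ ρ : ℝ, 0 < ρ → ∫ y in ball x ρ, max (f y - t) 0 ≤
          |c| * volume.real (ball (0 : Euc N) 1) * ρ ^ N := by
        intro ρ hρ
        have : ∫ y in ball x ρ, max (f y - t) 0 ≤ ∫ y in ball x ρ, |c| := by
          apply integral_mono hi.integrableOn (integrableOn_const measure_ball_lt_top.ne)
          exact (fun y => max_le (by linarith [hc y, le_abs_self c]) (abs_nonneg _))
        refine this.trans (le_of_eq ?_)
        rw [setIntegral_const, vball x hρ, smul_eq_mul]; ring
      obtain ⟨ρ, hρ, hρδ, hρτ, hρ4⟩ := select (N := N) (c := |c| * volume.real (ball (0 : Euc N) 1)) hτ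
        (show 0 < min δ (min (d1 / 5) (d2 / 2)) by positivity)
        (I := fun ρ => ∫ y in ball x ρ, max (f y - t) 0) hbd hfr
      · rw [lt_min_iff, lt_min_iff] at hρδ
        obtain ⟨h1, h2, h3⟩ := hρδ
        have hnot : ¬ VarLe (fun y => max (f y - t) 0) (ball x (2 * ρ))
            (K * (∫ y in ball x ρ, max (f y - t) 0) / ρ) := by
          intro hv
          have h4 := poinc hi (by fun_prop) (M := |c|) (fun _ => le_max_right _ _)
            (fun y => max_le (by linarith [hc y, le_abs_self c]) (abs_nonneg _)) hρ hε hε1 hv ?_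
          · have e : 2 * ε * ρ * (K * (∫ y in ball x ρ, max (f y - t) 0) / ρ) =
                1/2 * (∫ y in ball x ρ, max (f y - t) 0) := by
              simp only [ε]; field_simp; ring
            rw [e] at h4
            have : 0 < τ * ρ ^ N := by positivity
            linarith
          · have h5 := hd2' (show 2 * ρ ∈ Ioo 0 d2 from ⟨by linarith, by linarith⟩)
            simp only [mem_ofPred_eq] at h5
            have e : {w | 0 < max (f w - t) 0} = {y | t < f y} := by
              ext w; simp
            rw [e]
            refine h5.trans (le_of_eq ?_)
            rw [vball x (by positivity), vball 0 (show 0 < ε * ρ by positivity), mul_pow, mul_pow, pow_succ]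
            field_simp
        unfold VarLe at hnot
        push Not at hnot
        obtain ⟨ψ, hψ, hψ'⟩ := hnot
        refine ⟨ρ, ψ, fun _ => ⟨hρ, h1.le, ?_, hρτ, hρ4, hψ, hψ'.le⟩⟩
        exact (closedBall_subset_ball (by linarith)).trans hd1'
    choose ρ ψ hsel using hsel
    have hζ : ∀ x, ∃ ζ, 0 < ρ x → Cut C x (ρ x) ζ := by
      intro x
      by_cases h : 0 < ρ x
      · obtain ⟨ζ, hζ⟩ := hcut x _ h
        exact ⟨ζ, fun _ => hζ⟩
      · exact ⟨0, fun h' => absurd h' h⟩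
    choose ζ hζ using hζ
    refine (hpre_mono (show ENNReal.ofReal (10 * (4 * δ)) ≤ ENNReal.ofReal δ0 from
      ENNReal.ofReal_le_ofReal (by linarith)) A).trans ?_
    refine pre_vitali hN (r := fun x => 4 * ρ x) (fun x hx => ⟨?_, ?_⟩) ?_
    · have := (hsel x hx).1; positivity
    · have := (hsel x hx).2.1; linarith
    intro s hs hd
    have h1 := excess hf hm hU hVV ht hφ hφη.le hCφ s (fun x hx => (hsel x (hs hx)).1) hd
      (fun x hx => (hsel x (hs hx)).2.2.1) (fun x hx => hζ x (hsel x (hs hx)).1)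
      (fun x hx => (hsel x (hs hx)).2.2.2.2.2.1)
    have h2 : ∑ x ∈ s, (Cφ + C / ρ x) * ∫ y in ball x (4 * ρ x), max (f y - t) 0 ≤
        ∑ x ∈ s, (K - 1) * (∫ y in ball x (ρ x), max (f y - t) 0) / ρ x := by
      apply Finset.sum_le_sum
      intro x hx
      obtain ⟨a1, a2, a3, a4, a5, a6, a7⟩ := hsel x (hs hx)
      have hI : 0 ≤ ∫ y in ball x (ρ x), max (f y - t) 0 :=
        integral_nonneg fun y => le_max_right _ _
      have b1 : Cφ ≤ 1 / ρ x := by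
        rw [le_div_iff₀ a1]
        exact (mul_le_mul_of_nonneg_left a2 hCφ0).trans hδ2
      calc _ ≤ (1 / ρ x + C / ρ x) * (4 ^ (N + 1) * ∫ y in ball x (ρ x), max (f y - t) 0) := by
            apply mul_le_mul (by linarith) a5 (integral_nonneg fun y => le_max_right _ _)
            positivity
        _ = _ := by simp only [K]; field_simp; ring
    have h3 : ∑ x ∈ s, K * (∫ y in ball x (ρ x), max (f y - t) 0) / ρ x ≤
        ∑ x ∈ s, ∫ y, max (f y - t) 0 * diverg (ψ x) y :=
      Finset.sum_le_sum fun x hx => (hsel x (hs hx)).2.2.2.2.2.2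
    have h4 : ∑ x ∈ s, (∫ y in ball x (ρ x), max (f y - t) 0) / ρ x ≤ η := by
      have e : ∑ x ∈ s, (∫ y in ball x (ρ x), max (f y - t) 0) / ρ x =
          ∑ x ∈ s, K * (∫ y in ball x (ρ x), max (f y - t) 0) / ρ x -
          ∑ x ∈ s, (K - 1) * (∫ y in ball x (ρ x), max (f y - t) 0) / ρ x := by
        rw [← Finset.sum_sub_distrib]
        apply Finset.sum_congr rfl
        intro x _
        ring
      linarith
    have h5 : ∑ x ∈ s, (4 * ρ x) ^ (N - 1) ≤ ∑ x ∈ s, 4 ^ (N - 1) / τ *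
        ((∫ y in ball x (ρ x), max (f y - t) 0) / ρ x) := by
      apply Finset.sum_le_sum
      intro x hx
      obtain ⟨a1, a2, a3, a4, a5, a6, a7⟩ := hsel x (hs hx)
      have e : τ * ρ x ^ (N - 1) ≤ (∫ y in ball x (ρ x), max (f y - t) 0) / ρ x := by
        rw [le_div_iff₀ a1, mul_assoc, ← pow_succ, Nat.sub_add_cancel hN]
        exact a4.le
      calc (4 * ρ x) ^ (N - 1) = 4 ^ (N - 1) / τ * (τ * ρ x ^ (N - 1)) := by
            rw [mul_pow]; field_simp
        _ ≤ _ := by gcongr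
    rw [← Finset.mul_sum] at h5
    refine h5.trans ?_
    calc _ ≤ 4 ^ (N - 1) / τ * η := by gcongr
      _ = _ := by ring
  have lim : Tendsto (fun η : ℝ => ENNReal.ofReal (10 ^ (N - 1) * (4 ^ (N - 1) * (η / τ)))) (𝓝[>] 0) (𝓝 0) := by
    have : Continuous fun η : ℝ => ENNReal.ofReal (10 ^ (N - 1) * (4 ^ (N - 1) * (η / τ))) :=
      ENNReal.continuous_ofReal.comp (by fun_prop)
    have := (this.tendsto 0).mono_left (nhdsWithin_le_nhds (s := Ioi 0))
    simpa using this
  refine le_antisymm (ge_of_tendsto lim ?_) zero_le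
  filter_upwards [self_mem_nhdsWithin] with η hη
  exact main η hη

lemma step_box (hN : 1 ≤ N) {σ : ℝ} (hσ : 0 < σ) (hσ1 : σ ≤ 1/2) {f : Euc N → ℝ}
    (hf : Integrable f) (hm : Measurable f) {U : Set (Euc N)} (hU : IsOpen U) {S a R : ℝ}
    (hV : VarLe f U S) (ha : 0 < a) (hR : 0 < R)
    (hL : ∫ x, |f x| ≤ σ * a * volume.real (ball (0 : Euc N) (R / 2))) :
    hpre N (ENNReal.ofReal (40 * R)) {x | closedBall x (4 * R) ⊆ U ∧ ∃ ρ, 0 < ρ ∧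
      σ * volume.real (ball x ρ) < volume.real ({y | 2 * a < f y} ∩ ball x ρ)} ≤
    ENNReal.ofReal (40 ^ (N - 1) * (8 * 4 ^ N) / (σ * volume.real (ball (0 : Euc N) 1)) *
      (2 * (a⁻¹ * S))) := by
  have h1 := hV.pos hf hm hU ha.le
  have i1 := int_pos hf ha.le
  have m1 : Measurable fun x => max (f x - a) 0 := by fun_prop
  have h2 := h1.min i1 m1 hU ha.le
  have i2 : Integrable (fun x => min (max (f x - a) 0) a) := by
    refine i1.mono (by fun_prop) (Eventually.of_forall fun x => ?_)
    have := le_max_right (f x - a) 0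
    rw [Real.norm_eq_abs, Real.norm_eq_abs, abs_of_nonneg this, abs_of_nonneg (le_min this ha.le)]
    exact min_le_left _ _
  have m2 : Measurable fun x => min (max (f x - a) 0) a := by fun_prop
  obtain ⟨E, hE, hE1, hE2, hE3⟩ := coarea (i2.const_mul a⁻¹) (m2.const_mul a⁻¹) hU
    (h2.const_mul (inv_nonneg.2 ha.le))
    (fun x => mul_nonneg (inv_nonneg.2 ha.le) (le_min (le_max_right _ _) ha.le))
    (fun x => by
      rw [inv_mul_le_iff₀ ha, mul_one]; exact min_le_right _ _)
  have hE2' : ∀ x ∈ E, a < f x := by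
    intro x hx
    have := hE2 x hx
    rw [mul_pos_iff_of_pos_left (inv_pos.2 ha), lt_min_iff, lt_max_iff] at this
    rcases this.1 with h | h
    · linarith
    · exact absurd h (lt_irrefl _)
  have hE1' : ∀ x, 2 * a < f x → x ∈ E := by
    intro x hx
    apply hE1
    rw [max_eq_left (by linarith), min_eq_right (by linarith), inv_mul_cancel₀ ha.ne']
  have hsub : E ⊆ {x | a ≤ |f x|} := fun x hx => (hE2' x hx).le.trans (le_abs_self _)
  have hfinE : volume {x | a ≤ |f x|} < ⊤ := hf.norm.measure_ge_lt_top ha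
  have hvol : a * volume.real E ≤ ∫ x, |f x| := by
    refine (mul_le_mul_of_nonneg_left (measureReal_mono hsub hfinE.ne) ha.le).trans ?_
    exact mul_meas_ge_le_integral_of_nonneg (Eventually.of_forall fun x => abs_nonneg _) hf.abs a
  refine le_trans (measure_mono ?_) (boxing hN hE ((measure_mono hsub).trans_lt hfinE) hσ hσ1 hE3 hR ?_)
  · rintro x ⟨hx1, ρ, hρ, hx2⟩
    refine ⟨hx1, ρ, hρ, hx2.trans_le (measureReal_mono ?_ ?_)⟩
    · exact inter_subset_inter_left _ fun y hy => hE1' y hy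
    · exact ((measure_mono inter_subset_right).trans_lt measure_ball_lt_top).ne
  · have := hvol.trans hL
    rw [mul_comm σ a, mul_assoc] at this
    exact le_of_mul_le_mul_left this ha

lemma hasDensity_zero (A : Set (Euc N)) (x : Euc N) :
    HasDensity A x 0 ↔ ∀ m : ℕ, ∀ᶠ ρ in 𝓝[>] (0:ℝ), volume.real (A ∩ ball x ρ) ≤ 1 / (m + 1) * ρ ^ N := by
  unfold HasDensity
  have hω := omega_pos (N := N)
  have e : (fun ρ : ℝ => volume (A ∩ ball x ρ) / volume (ball x ρ)) =ᶠ[𝓝[>] 0]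
      fun ρ => ENNReal.ofReal (volume.real (A ∩ ball x ρ) / (ρ ^ N * volume.real (ball (0 : Euc N) 1))) := by
    filter_upwards [self_mem_nhdsWithin] with ρ hρ
    have hρ : 0 < ρ := hρ
    rw [← vball x hρ, ENNReal.ofReal_div_of_pos (by rw [vball x hρ]; positivity), measureReal_def, measureReal_def,
      ENNReal.ofReal_toReal, ENNReal.ofReal_toReal measure_ball_lt_top.ne]
    exact ((measure_mono inter_subset_right).trans_lt measure_ball_lt_top).ne
  rw [tendsto_congr' e, ENNReal.ofReal_zero]
  constructor
  · intro h m
    have : ENNReal.ofReal 0 < ENNReal.ofReal (1 / (m + 1) / volume.real (ball (0 : Euc N) 1)) := by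
      rw [ENNReal.ofReal_lt_ofReal_iff_of_nonneg le_rfl]; positivity
    rw [ENNReal.ofReal_zero] at this
    filter_upwards [h.eventually (gt_mem_nhds this), self_mem_nhdsWithin] with ρ h1 hρ
    have hρ : 0 < ρ := hρ
    rw [ENNReal.ofReal_lt_ofReal_iff_of_nonneg (by positivity), div_lt_div_iff₀ (by positivity) hω] at h1
    have h2 : volume.real (A ∩ ball x ρ) * volume.real (ball (0 : Euc N) 1) <
        (1 / (m + 1) * ρ ^ N) * volume.real (ball (0 : Euc N) 1) := by linarith
    exact (lt_of_mul_lt_mul_right h2 hω.le).le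
  · intro h
    rw [← ENNReal.ofReal_zero]
    apply ENNReal.tendsto_ofReal
    rw [Metric.tendsto_nhds]
    intro τ hτ
    obtain ⟨m, hm⟩ := exists_nat_one_div_lt (show 0 < τ * volume.real (ball (0 : Euc N) 1) by positivity)
    filter_upwards [h m, self_mem_nhdsWithin] with ρ h1 hρ
    have hρ : 0 < ρ := hρ
    rw [Real.dist_eq, sub_zero, abs_of_nonneg (by positivity), div_lt_iff₀ (by positivity)]
    refine h1.trans_lt ?_
    have := mul_lt_mul_of_pos_right hm (show 0 < ρ ^ N by positivity)
    linarith

lemma null_step (hN : 1 ≤ N) : ∃ σ : ℝ, 0 < σ ∧ σ ≤ 1/2 ∧ ∀ (f : Euc N → ℝ), Integrable f →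
    Measurable f → ∀ (U : Set (Euc N)), IsOpen U →
    ∀ (S : ℝ), VarLe f U S → ∀ (a : ℝ), 0 < a →
    (μH[(N : ℝ) - 1] : Measure (Euc N)) {x | x ∈ U ∧ 
      (∀ ρ : ℝ, 0 < ρ → volume.real ({y | 2 * a < f y} ∩ ball x ρ) ≤ σ * volume.real (ball x ρ)) ∧
      ¬ HasDensity {y | 3 * a < f y} x 0} = 0 := by
  obtain ⟨σ, hσ, hσ1, H⟩ := null_lemma hN
  refine ⟨σ, hσ, hσ1, ?_⟩
  intro f hf hm U hU S hV a ha
  have ha3 : 0 ≤ 3 * a := by positivity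
  have hi : Integrable (fun x => min (f x) (3 * a)) := by
    have h1 := hf.1
    refine hf.mono (by fun_prop) (Eventually.of_forall fun x => ?_)
    rw [Real.norm_eq_abs, Real.norm_eq_abs]
    rcases min_choice (f x) (3 * a) with h | h
    · rw [h]
    · rw [h, abs_of_nonneg ha3]
      exact (min_eq_right_iff.1 h).trans (le_abs_self _)
  have hmm : Measurable (fun x => min (f x) (3 * a)) := by fun_prop
  have key := fun m : ℕ => H _ hi hmm (3 * a) (fun x => min_le_right _ _) U hU S (hV.min hf hm hU ha3)
    (2 * a) (by positivity) (a * (1 / (m + 1))) (by positivity)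
  refine measure_mono_null ?_ (measure_iUnion_null key)
  rintro x ⟨hxU, hx1, hx2⟩
  rw [hasDensity_zero] at hx2
  push Not at hx2
  obtain ⟨m, hm'⟩ := hx2
  refine mem_iUnion.2 ⟨m, hxU, ?_, ?_⟩
  · filter_upwards [self_mem_nhdsWithin] with ρ hρ
    have e : {y | 2 * a < min (f y) (3 * a)} = {y | 2 * a < f y} := by
      ext y; simp only [mem_ofPred_eq, lt_min_iff]
      exact ⟨fun h => h.1, fun h => ⟨h, by linarith⟩⟩
    rw [e]
    exact hx1 ρ hρ
  · refine hm'.mono fun ρ hρ => ?_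
    have hms : MeasurableSet ({y | 3 * a < f y} ∩ ball x ρ) :=
      (measurableSet_lt measurable_const hm).inter measurableSet_ball
    have hii := int_pos hi (show 0 ≤ 2 * a by positivity)
    have h2 : a * volume.real ({y | 3 * a < f y} ∩ ball x ρ) ≤
        ∫ y in ball x ρ, max (min (f y) (3 * a) - 2 * a) 0 := by
      calc a * volume.real ({y | 3 * a < f y} ∩ ball x ρ) =
          ∫ y in {y | 3 * a < f y} ∩ ball x ρ, a := by
            rw [setIntegral_const, smul_eq_mul, mul_comm]
        _ ≤ ∫ y in {y | 3 * a < f y} ∩ ball x ρ, max (min (f y) (3 * a) - 2 * a) 0 := by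
            apply setIntegral_mono_on
            · exact integrableOn_const ((measure_mono inter_subset_right).trans_lt measure_ball_lt_top).ne
            · exact hii.integrableOn
            · exact hms
            · intro y hy
              have : 3 * a < f y := hy.1
              rw [min_eq_right this.le]
              exact le_trans (by linarith) (le_max_left _ _)
        _ ≤ _ := by
            apply setIntegral_mono_set hii.integrableOn
            · exact Eventually.of_forall fun y => le_max_right _ _
            · exact inter_subset_right.eventuallyLE
    refine lt_of_lt_of_le ?_ h2
    rw [mul_assoc]
    exact mul_lt_mul_of_pos_left hρ ha

/-- the smallness levels -/
def eps (N : ℕ) (j : ℕ) : ℝ := (1/8) ^ j * ((1/2) ^ j) ^ N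

lemma eps_pos (N j : ℕ) : 0 < eps N j := by unfold eps; positivity

lemma levels_pos (hN : 1 ≤ N) {U : Set (Euc N)} (hU : IsOpen U) {f : ℕ → Euc N → ℝ}
    (hf : ∀ j, Integrable (f j)) (hm : ∀ j, Measurable (f j))
    (hE : ∀ᶠ j in atTop, VarLe (f j) U (eps N j) ∧ ∫ x, |f j x| ≤ eps N j) :
    (μH[(N : ℝ) - 1] : Measure (Euc N)) {x | x ∈ U ∧
      ¬ ∀ᶠ j in atTop, HasDensity {y | 3 * (1/2) ^ j < f j y} x 0} = 0 := by
  obtain ⟨σ, hσ, hσ1, H⟩ := null_step hN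
  have hω := omega_pos (N := N)
  let P : ℕ → Prop := fun j => VarLe (f j) U (eps N j) ∧
    ∫ x, |f j x| ≤ σ * (1/2) ^ j * volume.real (ball (0 : Euc N) ((1/2) ^ j / 2))
  have hP : ∀ᶠ j in atTop, P j := by
    have h1 : Tendsto (fun j : ℕ => (1/4 : ℝ) ^ j) atTop (𝓝 0) :=
      tendsto_pow_atTop_nhds_zero_of_lt_one (by norm_num) (by norm_num)
    filter_upwards [hE, h1.eventually (gt_mem_nhds (show 0 < σ * volume.real (ball (0 : Euc N) 1) / 2 ^ N by positivity))]
      with j hj h2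
    refine ⟨hj.1, hj.2.trans ?_⟩
    rw [vball 0 (by positivity), div_pow ((1/2 : ℝ) ^ j) 2 N]
    unfold eps
    have e : (1/8 : ℝ) ^ j = (1/4) ^ j * (1/2) ^ j := by rw [← mul_pow]; norm_num
    rw [e]
    calc (1/4 : ℝ) ^ j * (1/2) ^ j * ((1/2) ^ j) ^ N ≤
        (σ * volume.real (ball (0 : Euc N) 1) / 2 ^ N) * (1/2) ^ j * ((1/2) ^ j) ^ N := by gcongr
      _ = _ := by ring
  let A : ℕ → Set (Euc N) := fun j => {x | P j ∧ closedBall x (4 * (1/2) ^ j) ⊆ U ∧ ∃ ρ, 0 < ρ ∧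
      σ * volume.real (ball x ρ) < volume.real ({y | 2 * (1/2) ^ j < f j y} ∩ ball x ρ)}
  let Z : ℕ → Set (Euc N) := fun j => {x | P j ∧ x ∈ U ∧ 
      (∀ ρ : ℝ, 0 < ρ → volume.real ({y | 2 * (1/2) ^ j < f j y} ∩ ball x ρ) ≤ σ * volume.real (ball x ρ)) ∧
      ¬ HasDensity {y | 3 * (1/2) ^ j < f j y} x 0}
  have hZ : ∀ j, (μH[(N : ℝ) - 1] : Measure (Euc N)) (Z j) = 0 := by
    intro j
    by_cases hj : P j
    · exact measure_mono_null (fun x hx => hx.2) (H (f j) (hf j) (hm j) U hU _ hj.1 ((1/2) ^ j) (by positivity))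
    · have : Z j = ∅ := eq_empty_of_forall_notMem fun x hx => hj hx.1
      rw [this, measure_empty]
  set C0 := 40 ^ (N - 1) * (8 * 4 ^ N) / (σ * volume.real (ball (0 : Euc N) 1)) with hC0
  have hC0p : 0 ≤ C0 := by positivity
  have hA : (μH[(N : ℝ) - 1] : Measure (Euc N)) {x | ∃ᶠ j in atTop, x ∈ A j} = 0 := by
    have hpow : Tendsto (fun j : ℕ => (1/2 : ℝ) ^ j) atTop (𝓝 0) :=
      tendsto_pow_atTop_nhds_zero_of_lt_one (by norm_num) (by norm_num)
    refine borel_cantelli (δ := fun j => 40 * (1/2) ^ j) (M := fun j => ENNReal.ofReal (C0 * (2 * (1/4) ^ j))) ?_ ?_ ?_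
    · simpa using hpow.const_mul 40
    · have hs : Summable fun j : ℕ => C0 * (2 * (1/4 : ℝ) ^ j) :=
        ((summable_geometric_of_lt_one (by norm_num) (by norm_num)).mul_left 2).mul_left C0
      rw [← ENNReal.ofReal_tsum_of_nonneg (fun j => by positivity) hs]
      exact ENNReal.ofReal_ne_top
    · intro j
      by_cases hj : P j
      · have h1 := step_box hN hσ hσ1 (hf j) (hm j) hU hj.1 (show (0:ℝ) < (1/2) ^ j by positivity)
          (show (0:ℝ) < (1/2) ^ j by positivity) hj.2
        refine (measure_mono fun x hx => hx.2).trans (h1.trans (ENNReal.ofReal_le_ofReal ?_))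
        rw [← hC0]
        gcongr
        rw [inv_mul_le_iff₀ (by positivity), ← mul_pow]
        unfold eps
        calc (1/8 : ℝ) ^ j * ((1/2) ^ j) ^ N ≤ (1/8 : ℝ) ^ j * 1 := by
              gcongr
              exact pow_le_one₀ (by positivity) (pow_le_one₀ (by norm_num) (by norm_num))
          _ = _ := by norm_num
      · have : A j = ∅ := eq_empty_of_forall_notMem fun x hx => hj hx.1
        rw [this, measure_empty]; exact zero_le
  refine measure_mono_null (t := {x | ∃ᶠ j in atTop, x ∈ A j} ∪ ⋃ j, Z j) ?_
    (measure_union_null hA (measure_iUnion_null hZ))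
  rintro x ⟨hxU, hx⟩
  by_contra hcon
  rw [mem_union, not_or] at hcon
  obtain ⟨h1, h2⟩ := hcon
  rw [mem_iUnion, not_exists] at h2
  have h1 : ∀ᶠ j in atTop, x ∉ A j := not_frequently.1 h1
  apply hx
  obtain ⟨d, hd, hd'⟩ := Metric.isOpen_iff.1 hU x hxU
  have hpow : Tendsto (fun j : ℕ => 4 * (1/2 : ℝ) ^ j) atTop (𝓝 0) := by
    simpa using (tendsto_pow_atTop_nhds_zero_of_lt_one (r := (1/2 : ℝ)) (by norm_num) (by norm_num)).const_mul 4
  filter_upwards [h1, hP, hpow.eventually (gt_mem_nhds hd)] with j h3 h4 h5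
  by_contra h6
  refine h2 j ⟨h4, hxU, fun ρ hρ => ?_, h6⟩
  by_contra h7
  exact h3 ⟨h4, (closedBall_subset_ball h5).trans hd', ρ, hρ, not_le.1 h7⟩

lemma levels {U : Set (Euc N)} (hU : IsOpen U) {f : ℕ → Euc N → ℝ}
    (hf : ∀ j, Integrable (f j)) (hm : ∀ j, Measurable (f j))
    (hE : ∀ᶠ j in atTop, VarLe (f j) U (eps N j) ∧ ∫ x, |f j x| ≤ eps N j) :
    (μH[(N : ℝ) - 1] : Measure (Euc N)) {x | x ∈ U ∧
      ¬ ∀ᶠ j in atTop, HasDensity {y | 3 * (1/2) ^ j < f j y} x 0} = 0 := by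
  rcases Nat.eq_zero_or_pos N with h0 | hN
  swap
  · exact levels_pos hN hU hf hm hE
  subst h0
  have : {x | x ∈ U ∧ ¬ ∀ᶠ j in atTop, HasDensity {y | 3 * (1/2) ^ j < f j y} x 0} = ∅ := by
    refine eq_empty_of_forall_notMem fun x hx => hx.2 ?_
    filter_upwards [hE] with j hj
    have e : {y | 3 * (1/2) ^ j < f j y} = ∅ := by
      refine eq_empty_of_forall_notMem fun y hy => ?_
      have hy : 3 * (1/2) ^ j < f j y := hy
      have h1 := hj.2
      have h2 : ∀ z, |f j z| = |f j y| := fun z => by rw [Subsingleton.elim z y]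
      simp_rw [h2] at h1
      rw [integral_const, smul_eq_mul] at h1
      have hv : volume.real (univ : Set (Euc 0)) = 1 := by
        have h5 := (EuclideanSpace.volume_preserving_symm_measurableEquiv_toLp (Fin 0)).measure_preimage
          (MeasurableSet.univ).nullMeasurableSet
        rw [preimage_univ, volume_pi, Measure.pi_of_empty] at h5
        rw [measureReal_def, h5]; simp
      rw [hv, one_mul] at h1
      unfold eps at h1
      have h3 : (1/8 : ℝ) ^ j ≤ (1/2) ^ j := by gcongr; norm_num
      have h4 : (0:ℝ) < (1/2) ^ j := by positivity
      have := le_abs_self (f j y)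
      simp only [pow_zero, mul_one] at h1
      linarith
    rw [e, hasDensity_zero]
    intro m
    filter_upwards [self_mem_nhdsWithin] with ρ hρ
    have hρ : 0 < ρ := hρ
    simp only [empty_inter, measureReal_empty]
    positivity
  rw [this, measure_empty]

lemma HasDensity.mono_ae {A B : Set (Euc N)} {x : Euc N} {U : Set (Euc N)} (hU : IsOpen U)
    (hx : x ∈ U) (h : HasDensity B x 0) (hAB : volume ((A ∩ U) \ B) = 0) : HasDensity A x 0 := by
  rw [hasDensity_zero] at h ⊢
  intro m
  obtain ⟨d, hd, hd'⟩ := Metric.isOpen_iff.1 hU x hx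
  filter_upwards [h m, Ioo_mem_nhdsGT hd] with ρ h1 h2
  refine le_trans ?_ h1
  have hsub : A ∩ ball x ρ ⊆ (B ∩ ball x ρ) ∪ ((A ∩ U) \ B) := by
    rintro y ⟨hy1, hy2⟩
    by_cases hy : y ∈ B
    · exact Or.inl ⟨hy, hy2⟩
    · exact Or.inr ⟨⟨hy1, hd' (ball_subset_ball h2.2.le hy2)⟩, hy⟩
  have hfin : volume (B ∩ ball x ρ) ≠ ⊤ := ((measure_mono inter_subset_right).trans_lt measure_ball_lt_top).ne
  unfold Measure.real
  apply ENNReal.toReal_mono hfin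
  calc volume (A ∩ ball x ρ) ≤ volume (B ∩ ball x ρ) + volume ((A ∩ U) \ B) :=
        (measure_mono hsub).trans (measure_union_le _ _)
    _ = _ := by rw [hAB, add_zero]

lemma HasDensity.union {A B : Set (Euc N)} {x : Euc N} (hA : HasDensity A x 0)
    (hB : HasDensity B x 0) : HasDensity (A ∪ B) x 0 := by
  unfold HasDensity at *
  rw [ENNReal.ofReal_zero] at *
  have := hA.add hB
  rw [add_zero] at this
  refine tendsto_of_tendsto_of_tendsto_of_le_of_le tendsto_const_nhds this (fun _ => zero_le) fun ρ => ?_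
  show volume ((A ∪ B) ∩ ball x ρ) / volume (ball x ρ) ≤ _
  rw [← ENNReal.add_div, union_inter_distrib_right]
  exact ENNReal.div_le_div_right (measure_union_le _ _) _

lemma HasDensity.mono {A B : Set (Euc N)} {x : Euc N} (hB : HasDensity B x 0) (h : A ⊆ B) :
    HasDensity A x 0 :=
  HasDensity.mono_ae isOpen_univ (mem_univ x) hB (by
    rw [inter_univ, sdiff_eq_empty.2 h, measure_empty])

lemma upper_le {Ω : Set (Euc N)} {u v : Euc N → ℝ} {x : Euc N} {c : ℝ}
    (h : HasDensity {y | y ∈ Ω ∧ c < u y - v y} x 0) :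
    approxUpper u Ω x ≤ approxUpper v Ω x + c := by
  have h1 : approxUpper u Ω x - c ≤ approxUpper v Ω x := by
    refine le_sInf ?_
    rintro _ ⟨s, rfl, hs⟩
    rw [EReal.sub_le_iff_le_add (Or.inl (EReal.coe_ne_bot c)) (Or.inl (EReal.coe_ne_top c))]
    refine sInf_le ⟨s + c, by push_cast; rfl, (hs.union h).mono ?_⟩
    rintro y ⟨hy1, hy2⟩
    by_cases hy : s < v y
    · exact Or.inl ⟨hy1, hy⟩
    · exact Or.inr ⟨hy1, by push Not at hy; linarith⟩
  rwa [EReal.sub_le_iff_le_add (Or.inl (EReal.coe_ne_bot c)) (Or.inl (EReal.coe_ne_top c))] at h1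

lemma tendsto_upper {Ω : Set (Euc N)} {u : ℕ → Euc N → ℝ} {v : Euc N → ℝ} {x : Euc N} {c : ℕ → ℝ}
    (hc : Tendsto c atTop (𝓝 0))
    (h1 : ∀ᶠ j in atTop, HasDensity {y | y ∈ Ω ∧ c j < u j y - v y} x 0)
    (h2 : ∀ᶠ j in atTop, HasDensity {y | y ∈ Ω ∧ c j < v y - u j y} x 0) :
    Tendsto (fun j => approxUpper (u j) Ω x) atTop (𝓝 (approxUpper v Ω x)) := by
  have hcE : Tendsto (fun j => ((c j : ℝ) : EReal)) atTop (𝓝 ((0 : ℝ) : EReal)) :=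
    (continuous_coe_real_ereal.tendsto 0).comp hc
  have hcE' : Tendsto (fun j => ((-c j : ℝ) : EReal)) atTop (𝓝 ((-0 : ℝ) : EReal)) :=
    (continuous_coe_real_ereal.tendsto (-0)).comp hc.neg
  set V := approxUpper v Ω x
  have t1 : Tendsto (fun j => V + ((c j : ℝ) : EReal)) atTop (𝓝 V) := by
    have := (EReal.continuousAt_add (p := (V, ((0 : ℝ) : EReal))) (Or.inr (EReal.coe_ne_bot 0))
      (Or.inr (EReal.coe_ne_top 0))).tendsto.comp ((tendsto_const_nhds (x := V)).prodMk_nhds hcE)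
    simpa [Function.comp_def] using this
  have t2 : Tendsto (fun j => V + ((-c j : ℝ) : EReal)) atTop (𝓝 V) := by
    have := (EReal.continuousAt_add (p := (V, ((-0 : ℝ) : EReal))) (Or.inr (EReal.coe_ne_bot _))
      (Or.inr (EReal.coe_ne_top _))).tendsto.comp ((tendsto_const_nhds (x := V)).prodMk_nhds hcE')
    simpa [Function.comp_def] using this
  refine tendsto_of_tendsto_of_tendsto_of_le_of_le' t2 t1 ?_ ?_
  · filter_upwards [h2] with j hj
    have := upper_le hj
    rw [EReal.coe_neg, ← sub_eq_add_neg, 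
      EReal.sub_le_iff_le_add (Or.inl (EReal.coe_ne_bot _)) (Or.inl (EReal.coe_ne_top _))]
    exact this
  · filter_upwards [h1] with j hj
    exact upper_le hj

lemma exists_rep {U : Set (Euc N)} (hU : IsOpen U) {w : Euc N → ℝ} (hw : IntegrableOn w U) :
    ∃ f : Euc N → ℝ, Integrable f ∧ Measurable f ∧ (∀ᵐ x ∂(volume.restrict U), f x = w x) ∧
    ∀ ε : ℝ, 0 ≤ ε → eLpNorm w 1 (volume.restrict U) + variation w U ≤ ENNReal.ofReal ε →
      VarLe f U ε ∧ ∫ x, |f x| ≤ ε := by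
  have hae := hw.1.ae_eq_mk
  let g := hw.1.mk w
  have hg : Measurable g := hw.1.stronglyMeasurable_mk.measurable
  have hgi : IntegrableOn g U := hw.congr hae
  refine ⟨U.indicator g, (integrable_indicator_iff hU.measurableSet).2 hgi, hg.indicator hU.measurableSet, ?_, ?_⟩
  · filter_upwards [hae, ae_restrict_mem hU.measurableSet] with x hx hxU
    rw [indicator_of_mem hxU, hx]
  · intro ε hε hle
    have hle1 := le_self_add.trans hle
    have hle2 := le_add_self.trans hle
    constructor
    · intro φ hφ
      have e : ∫ x, U.indicator g x * diverg φ x = ∫ x in U, w x * diverg φ x := by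
        rw [← integral_indicator hU.measurableSet]
        have : ∀ x, U.indicator g x * diverg φ x = U.indicator (fun x => g x * diverg φ x) x := by
          intro x
          by_cases hx : x ∈ U <;> simp [hx]
        simp_rw [this]
        rw [integral_indicator hU.measurableSet, integral_indicator hU.measurableSet]
        apply integral_congr_ae
        filter_upwards [hae] with x hx
        rw [hx]
      rw [e]
      rw [← ENNReal.ofReal_le_ofReal_iff hε]
      refine le_trans ?_ hle2
      unfold variation
      exact le_iSup₂ (f := fun φ (_ : φ ∈ TestVF U) => ENNReal.ofReal (∫ x in U, w x * diverg φ x)) φ hφ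
    · have e : ∫ x, |U.indicator g x| = ∫ x in U, ‖w x‖ := by
        have : ∀ x, |U.indicator g x| = U.indicator (fun x => ‖g x‖) x := by
          intro x
          by_cases hx : x ∈ U <;> simp [hx]
        simp_rw [this]
        rw [integral_indicator hU.measurableSet]
        apply integral_congr_ae
        filter_upwards [hae] with x hx
        rw [hx]
      rw [e, integral_norm_eq_lintegral_enorm hw.1, ← eLpNorm_one_eq_lintegral_enorm]
      exact ENNReal.toReal_le_of_le_ofReal hε hle1

/-- if `{u_k} ⊆ BV_loc(Ω)` and `u ∈ BV_loc(Ω)` with `u_k → u` strongly in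
`BV_loc(Ω)` (i.e. `‖u_k − u‖_{L¹(Ω')} + V(u_k − u, Ω') → 0` for every open `Ω'` compactly
contained in `Ω`), then a subsequence satisfies `u_{k_j}⁺(x) → u⁺(x)` for `H^{N-1}`-a.e.
`x ∈ Ω`. -/
theorem statement13 {N : ℕ} (Ω : Set (Euc N)) (hΩ : IsOpen Ω)
    (u : ℕ → Euc N → ℝ) (v : Euc N → ℝ)
    (hBV : ∀ k, MemBVloc (u k) Ω) (hvBV : MemBVloc v Ω)
    (hconv : ∀ Ω' : Set (Euc N), IsOpen Ω' → IsCompact (closure Ω') → closure Ω' ⊆ Ω →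
      Tendsto (fun k =>
          eLpNorm (fun x => u k x - v x) 1 (volume.restrict Ω') +
            variation (fun x => u k x - v x) Ω') atTop (𝓝 0)) :
    ∃ φ : ℕ → ℕ, StrictMono φ ∧
      ∀ᵐ x ∂((μH[(N : ℝ) - 1] : Measure (Euc N)).restrict Ω),
        Tendsto (fun j => approxUpper (u (φ j)) Ω x) atTop (𝓝 (approxUpper v Ω x)) := by
  classical
  rcases Ω.eq_empty_or_nonempty with rfl | hne
  · exact ⟨id, strictMono_id, by simp⟩
  -- countable cover by balls
  have hr : ∀ x ∈ Ω, ∃ r : ℝ, 0 < r ∧ closedBall x r ⊆ Ω := fun x hx =>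
    Metric.nhds_basis_closedBall.mem_iff.1 (hΩ.mem_nhds hx)
  choose! r hr0 hrΩ using hr
  obtain ⟨t, htΩ, htc, hcov⟩ := TopologicalSpace.countable_cover_nhdsWithin
    (f := fun x => ball x (r x)) (s := Ω)
    (fun x hx => mem_nhdsWithin_of_mem_nhds (ball_mem_nhds x (hr0 x hx)))
  have htne : t.Nonempty := by
    obtain ⟨x, hx⟩ := hne
    obtain ⟨y, hy, _⟩ := mem_iUnion₂.1 (hcov hx)
    exact ⟨y, hy⟩
  obtain ⟨p, hp⟩ := htc.exists_eq_range htne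
  have hpΩ : ∀ i, p i ∈ Ω := fun i => htΩ (hp ▸ mem_range_self i)
  let U : ℕ → Set (Euc N) := fun i => ball (p i) (r (p i))
  have hU : ∀ i, IsOpen (U i) := fun i => isOpen_ball
  have hUcl : ∀ i, closure (U i) ⊆ closedBall (p i) (r (p i)) := fun i => closure_ball_subset_closedBall
  have hUc : ∀ i, IsCompact (closure (U i)) := fun i =>
    (isCompact_closedBall _ _).of_isClosed_subset isClosed_closure (hUcl i)
  have hUΩ : ∀ i, closure (U i) ⊆ Ω := fun i => (hUcl i).trans (hrΩ _ (hpΩ i))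
  have hcovU : ∀ x ∈ Ω, ∃ i, x ∈ U i := by
    intro x hx
    obtain ⟨y, hy, hxy⟩ := mem_iUnion₂.1 (hcov hx)
    rw [hp] at hy
    obtain ⟨i, rfl⟩ := hy
    exact ⟨i, hxy⟩
  -- the subsequence
  obtain ⟨φ, hφ, hφP⟩ := extraction_forall_of_eventually (P := fun n k => ∀ i ≤ n,
      eLpNorm (fun x => u k x - v x) 1 (volume.restrict (U i)) +
            variation (fun x => u k x - v x) (U i) ≤ ENNReal.ofReal (eps N n)) (by
    intro n
    have h : ∀ i ∈ Finset.range (n + 1), ∀ᶠ k in atTop,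
        eLpNorm (fun x => u k x - v x) 1 (volume.restrict (U i)) +
            variation (fun x => u k x - v x) (U i) ≤ ENNReal.ofReal (eps N n) := fun i _ =>
      ((hconv (U i) (hU i) (hUc i) (hUΩ i)).eventually
        (gt_mem_nhds (ENNReal.ofReal_pos.2 (eps_pos N n)))).mono fun k hk => hk.le
    filter_upwards [(Filter.eventually_all_finset _).2 h] with k hk i hi
    exact hk i (Finset.mem_range.2 (by omega)))
  refine ⟨φ, hφ, ?_⟩
  have hwint : ∀ i j, IntegrableOn (fun x => u (φ j) x - v x) (U i) := fun i j =>
    ((hBV (φ j) (U i) (hU i) (hUc i) (hUΩ i)).1).sub (hvBV (U i) (hU i) (hUc i) (hUΩ i)).1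
  choose f hf hm hae hE using fun i j => exists_rep (hU i) (hwint i j)
  have hE' : ∀ i, ∀ᶠ j in atTop, VarLe (f i j) (U i) (eps N j) ∧ ∫ x, |f i j x| ≤ eps N j := by
    intro i
    filter_upwards [eventually_ge_atTop i] with j hj
    exact hE i j _ (eps_pos N j).le (hφP j i hj)
  have n1 := fun i => levels (hU i) (hf i) (hm i) (hE' i)
  have n2 := fun i => levels (hU i) (f := fun j x => - f i j x) (fun j => (hf i j).neg)
    (fun j => (hm i j).neg) ((hE' i).mono fun j hj => ⟨hj.1.neg, by simpa using hj.2⟩)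
  rw [ae_restrict_iff' hΩ.measurableSet, ae_iff]
  refine measure_mono_null ?_ (measure_union_null (measure_iUnion_null n1) (measure_iUnion_null n2))
  intro x hx
  by_contra hcon
  apply hx
  intro hxΩ
  obtain ⟨i, hi⟩ := hcovU x hxΩ
  rw [mem_union, not_or, mem_iUnion, mem_iUnion, not_exists, not_exists] at hcon
  have g1 : ∀ᶠ j in atTop, HasDensity {y | 3 * (1/2) ^ j < f i j y} x 0 := by
    by_contra h
    exact hcon.1 i ⟨hi, h⟩
  have g2 : ∀ᶠ j in atTop, HasDensity {y | 3 * (1/2) ^ j < - f i j y} x 0 := by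
    by_contra h
    exact hcon.2 i ⟨hi, h⟩
  have hnull : ∀ j, volume ({y | f i j y ≠ u (φ j) y - v y} ∩ U i) = 0 := by
    intro j
    have h := hae i j
    rw [ae_restrict_iff' (hU i).measurableSet, ae_iff] at h
    refine measure_mono_null ?_ h
    rintro y ⟨hy1, hy2⟩
    exact fun h => hy1 (h hy2)
  refine tendsto_upper (c := fun j => 3 * (1/2) ^ j) ?_ ?_ ?_
  · simpa using (tendsto_pow_atTop_nhds_zero_of_lt_one (r := (1/2 : ℝ)) (by norm_num) (by norm_num)).const_mul 3
  · filter_upwards [g1] with j hj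
    refine HasDensity.mono_ae (hU i) hi hj (measure_mono_null ?_ (hnull j))
    rintro y ⟨⟨⟨_, hy1⟩, hy2⟩, hy3⟩
    refine ⟨fun h => hy3 ?_, hy2⟩
    show 3 * (1/2) ^ j < f i j y
    rw [h]; exact hy1
  · filter_upwards [g2] with j hj
    refine HasDensity.mono_ae (hU i) hi hj (measure_mono_null ?_ (hnull j))
    rintro y ⟨⟨⟨_, hy1⟩, hy2⟩, hy3⟩
    refine ⟨fun h => hy3 ?_, hy2⟩
    show 3 * (1/2) ^ j < - f i j y
    rw [h, neg_sub]; exact hy1
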